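/- arXiv:1204.1308 — 4 statements merged into one kernel-verified Lean document; each statement's English description precedes it below -/
import Mathlib

section
/- Let n ≥ 1 and let P ⊆ ℝⁿ be a compact set with nonempty interior of the form P = {x ∈ ℝⁿ : ⟨l_F, x⟩ ≥ −a_F for all F in a finite index set}, where each l_F ∈ ℤⁿ is a primitive lattice vector (its integer coordinates have greatest common divisor 1) and each a_F is a rational number with 0 < a_F ≤ 1. If the barycenter of P is the origin, then Vol(P) ≤ (n+1)ⁿ/n!. -/
open MeasureTheory
open scoped Pointwise

namespace ToricVol

/-- Laurent polynomials over the field with two elements. -/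
abbrev LR (n : ℕ) := AddMonoidAlgebra (ZMod 2) (Fin n → ℤ)

/-- Laurent monomial. -/
noncomputable abbrev xm {n : ℕ} (m : Fin n → ℤ) : LR n := AddMonoidAlgebra.single m 1

/-- `x_i - 1`. -/
noncomputable def yy {n : ℕ} (i : Fin n) : LR n := xm (Pi.single i 1) - 1

/-- The ideal of the point `(1,…,1)`. -/
noncomputable def II (n : ℕ) : Ideal (LR n) := Ideal.span (Set.range yy)

lemma xm_add {n : ℕ} (a b : Fin n → ℤ) : xm (a + b) = xm a * xm b := by
  simp [xm, AddMonoidAlgebra.single_mul_single]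

lemma xm_zero {n : ℕ} : xm (0 : Fin n → ℤ) = 1 := rfl

lemma xm_sub_one_mem {n : ℕ} (m : Fin n → ℤ) : xm m - 1 ∈ II n := by
  let H : AddSubgroup (Fin n → ℤ) :=
    { carrier := {m | xm m - 1 ∈ II n}
      zero_mem' := by simp [xm_zero]
      add_mem' := by
        intro a b ha hb
        simp only [Set.mem_ofPred_eq] at *
        have : xm (a + b) - 1 = xm a * (xm b - 1) + (xm a - 1) := by rw [xm_add]; ring
        rw [this]
        exact add_mem (Ideal.mul_mem_left _ _ hb) ha
      neg_mem' := by
        intro a ha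
        simp only [Set.mem_ofPred_eq] at *
        have h1 : xm (-a) * xm a = 1 := by rw [← xm_add]; simp [xm_zero]
        have : xm (-a) - 1 = -(xm (-a)) * (xm a - 1) := by linear_combination h1
        rw [this]
        exact Ideal.mul_mem_left _ _ ha }
  change m ∈ H
  rw [← Finset.univ_sum_single m]
  refine sum_mem fun i _ => ?_
  have : (Pi.single i (m i) : Fin n → ℤ) = (m i) • Pi.single i (1 : ℤ) := by
    rw [← Pi.single_smul]; simp
  rw [this]
  refine AddSubgroup.zsmul_mem _ ?_ _
  exact Ideal.subset_span ⟨i, rfl⟩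

lemma exists_const {n : ℕ} (f : LR n) : ∃ c : ZMod 2, f - c • 1 ∈ II n := by
  induction f using AddMonoidAlgebra.induction_linear with
  | zero => exact ⟨0, by simp⟩
  | add f g hf hg =>
    obtain ⟨c, hc⟩ := hf
    obtain ⟨d, hd⟩ := hg
    refine ⟨c + d, ?_⟩
    have : f + g - (c + d) • (1 : LR n) = (f - c • 1) + (g - d • 1) := by rw [add_smul]; ring
    rw [this]; exact add_mem hc hd
  | single m r =>
    refine ⟨r, ?_⟩
    have : (AddMonoidAlgebra.single m r : LR n) - r • 1 = r • (xm m - 1) := by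
      rw [smul_sub, xm, AddMonoidAlgebra.smul_single]; simp
    rw [this]
    exact Submodule.smul_of_tower_mem _ _ (xm_sub_one_mem m)

/-- generators `1, y_i` -/
noncomputable def y' {n : ℕ} : Option (Fin n) → LR n := fun o => o.elim 1 yy

/-- span of products -/
noncomputable def WW (n : ℕ) : Submodule (ZMod 2) (LR n) := Submodule.span (ZMod 2) (Set.range y')

lemma pow_le {n : ℕ} (s : ℕ) :
    ((II n) ^ s).restrictScalars (ZMod 2) ≤ (WW n) ^ s ⊔ ((II n) ^ (s + 1)).restrictScalars (ZMod 2) := by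
  intro f hf
  rw [Submodule.restrictScalars_mem] at hf
  have hI : (II n) ^ s = Ideal.span ((Set.range yy) ^ s) := by rw [II, Ideal.span, Submodule.span_pow]
  have hf' := hf
  rw [hI] at hf'
  induction hf' using Submodule.span_induction with
  | mem x hx =>
    refine Submodule.mem_sup_left ?_
    rw [WW, Submodule.span_pow]
    refine Submodule.subset_span ?_
    refine Set.pow_subset_pow_left ?_ hx
    rintro _ ⟨i, rfl⟩
    exact ⟨some i, rfl⟩
  | zero => exact zero_mem _
  | add x y hx hy ihx ihy => exact add_mem (ihx (hI ▸ hx)) (ihy (hI ▸ hy))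
  | smul r x hx ih =>
    have hx' : x ∈ II n ^ s := hI ▸ hx
    obtain ⟨c, hc⟩ := exists_const r
    have : r • x = c • x + (r - c • 1) * x := by
      simp [sub_mul]
    rw [this]
    refine add_mem (Submodule.smul_mem _ _ (ih hx')) (Submodule.mem_sup_right ?_)
    rw [Submodule.restrictScalars_mem, pow_succ']
    exact Ideal.mul_mem_mul hc hx'

lemma one_le_WW {n : ℕ} : 1 ≤ WW n := by
  rw [Submodule.one_le]
  exact Submodule.subset_span ⟨none, rfl⟩

lemma top_le {n : ℕ} (t : ℕ) :
    ⊤ ≤ (WW n) ^ t ⊔ ((II n) ^ (t + 1)).restrictScalars (ZMod 2) := by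
  induction t with
  | zero =>
    intro f _
    obtain ⟨c, hc⟩ := exists_const f
    rw [← sub_add_cancel f (c • 1)]
    refine add_mem (Submodule.mem_sup_right (by simpa using hc)) (Submodule.mem_sup_left ?_)
    rw [pow_zero]
    exact Submodule.smul_mem _ _ (Submodule.one_le.1 le_rfl)
  | succ t ih =>
    refine ih.trans (sup_le ?_ (pow_le (t + 1)))
    refine le_trans ?_ le_sup_left
    rw [pow_succ]
    exact le_mul_of_one_le_right' one_le_WW

lemma finrank_quot_le {n : ℕ} (t : ℕ) :
    Module.Finite (ZMod 2) (LR n ⧸ (II n) ^ (t + 1)) ∧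
    Module.finrank (ZMod 2) (LR n ⧸ (II n) ^ (t + 1)) ≤ (n + t).choose n := by
  classical
  let Q : LR n →ₗ[ZMod 2] (LR n ⧸ (II n) ^ (t + 1)) := (Ideal.Quotient.mkₐ (ZMod 2) _).toLinearMap
  let φ : Sym (Option (Fin n)) t → (LR n ⧸ (II n) ^ (t + 1)) := fun s => Q ((s.1.map y').prod)
  have hsub : (Set.range y') ^ t ⊆ Set.range (fun s : Sym (Option (Fin n)) t => ((s.1.map y').prod : LR n)) := by
    intro x hx
    rw [Set.mem_pow] at hx
    obtain ⟨f, rfl⟩ := hx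
    choose g hg using fun i => (f i).2
    refine ⟨⟨(List.ofFn g : Multiset _), by simp⟩, ?_⟩
    simp only [Multiset.map_coe, Multiset.prod_coe, List.map_ofFn]
    congr 2
    funext i
    exact hg i
  have hspan : ⊤ ≤ Submodule.span (ZMod 2) (Set.range φ) := by
    intro z _
    obtain ⟨f, rfl⟩ := Ideal.Quotient.mk_surjective z
    have := top_le t (Submodule.mem_top (x := f))
    obtain ⟨w, hw, i, hi, rfl⟩ := Submodule.mem_sup.1 this
    rw [Submodule.restrictScalars_mem] at hi
    rw [map_add, Ideal.Quotient.eq_zero_iff_mem.2 hi, add_zero]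
    rw [WW, Submodule.span_pow] at hw
    have h2 : Q w ∈ Submodule.map Q (Submodule.span (ZMod 2) (Set.range y' ^ t)) := ⟨w, hw, rfl⟩
    rw [Submodule.map_span] at h2
    refine Submodule.span_mono ?_ h2
    rintro _ ⟨v, hv, rfl⟩
    obtain ⟨s, hs⟩ := hsub hv
    exact ⟨s, by simp [φ, ← hs]⟩
  have htop : Submodule.span (ZMod 2) (Set.range φ) = ⊤ := top_le_iff.1 hspan
  refine ⟨⟨?_⟩, ?_⟩
  · rw [← htop]; exact Submodule.fg_span (Set.finite_range _)
  · rw [← finrank_top, ← htop]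
    refine (finrank_range_le_card φ).trans ?_
    rw [Sym.card_sym_eq_choose]
    simp only [Fintype.card_option, Fintype.card_fin]
    rw [show n + 1 + t - 1 = n + t by omega, Nat.choose_symm_add]


/-- `u` is the lexicographically largest exponent of `f`. -/
def Lead {n : ℕ} (f : LR n) (u : Fin n → ℤ) : Prop :=
  f.coeff u ≠ 0 ∧ ∀ m, f.coeff m ≠ 0 → toLex m ≤ toLex u

lemma coeff_mul_ne {n : ℕ} {f g : LR n} {m : Fin n → ℤ} (h : (f * g).coeff m ≠ 0) :
    ∃ a b, f.coeff a ≠ 0 ∧ g.coeff b ≠ 0 ∧ a + b = m := by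
  classical
  have h1 : m ∈ (f * g).coeff.support := by simpa using h
  have := AddMonoidAlgebra.support_coeff_mul_subset f g h1
  obtain ⟨a, ha, b, hb, hab⟩ := Finset.mem_add.1 this
  exact ⟨a, b, by simpa using ha, by simpa using hb, hab⟩

lemma Lead.mul {n : ℕ} {f g : LR n} {u v : Fin n → ℤ} (hf : Lead f u) (hg : Lead g v) :
    Lead (f * g) (u + v) := by
  refine ⟨?_, ?_⟩
  · rw [AddMonoidAlgebra.coeff_mul_add_of_uniqueAdd]
    · exact mul_ne_zero hf.1 hg.1
    · intro a b ha hb hab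
      have h1 : toLex a ≤ toLex u := hf.2 a (by simpa using ha)
      have h2 : toLex b ≤ toLex v := hg.2 b (by simpa using hb)
      have h3 : toLex a + toLex b = toLex u + toLex v := by
        rw [← toLex_add, ← toLex_add, hab]
      have := (add_eq_add_iff_eq_and_eq h1 h2).1 h3
      exact ⟨toLex.injective this.1, toLex.injective this.2⟩
  · intro m hm
    obtain ⟨a, b, ha, hb, rfl⟩ := coeff_mul_ne hm
    rw [toLex_add, toLex_add]
    exact add_le_add (hf.2 a ha) (hg.2 b hb)

lemma Lead.xm {n : ℕ} (u : Fin n → ℤ) : Lead (xm u) u := by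
  classical
  refine ⟨by simp, ?_⟩
  intro m hm
  rw [AddMonoidAlgebra.coeff_single, Finsupp.single_apply] at hm
  by_cases h : u = m
  · rw [h]
  · simp [h] at hm

lemma Lead.one {n : ℕ} : Lead (1 : LR n) 0 := Lead.xm 0

lemma Lead.pow {n : ℕ} {f : LR n} (hf : Lead f 0) (j : ℕ) : Lead (f ^ j) 0 := by
  induction j with
  | zero => simpa using Lead.one
  | succ j ih => rw [pow_succ]; simpa using ih.mul hf

lemma Lead.prod {n : ℕ} (A : Finset (Fin n → ℤ)) (f : (Fin n → ℤ) → LR n)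
    (h : ∀ u ∈ A, Lead (f u) u) : Lead (∏ u ∈ A, f u) (∑ u ∈ A, u) := by
  classical
  induction A using Finset.induction_on with
  | empty => simpa using Lead.one
  | insert u A hu ih =>
    rw [Finset.prod_insert hu, Finset.sum_insert hu]
    exact (h u (by simp)).mul (ih fun v hv => h v (by simp [hv]))

lemma exists_lead {n : ℕ} {f : LR n} (hf : f ≠ 0) : ∃ u, Lead f u := by
  have : f.coeff.support.Nonempty := by
    rw [Finsupp.support_nonempty_iff]; simpa using hf
  obtain ⟨u, hu, hmax⟩ := Finset.exists_max_image f.coeff.support toLex this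
  exact ⟨u, by simpa using hu, fun m hm => hmax m (by simpa using hm)⟩

/-- integral pairing -/
def pr {n : ℕ} (l m : Fin n → ℤ) : ℤ := ∑ i, l i * m i

lemma pr_add {n : ℕ} (l a b : Fin n → ℤ) : pr l (a + b) = pr l a + pr l b := by
  simp [pr, mul_add, Finset.sum_add_distrib]

lemma pr_neg {n : ℕ} (l a : Fin n → ℤ) : pr l (-a) = - pr l a := by
  simp [pr]

lemma pr_smul {n : ℕ} (l a : Fin n → ℤ) (c : ℤ) : pr l (c • a) = c * pr l a := by
  simp only [pr, Finset.mul_sum, Pi.smul_apply, smul_eq_mul]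
  exact Finset.sum_congr rfl fun i _ => by ring

/-- support bounded below in direction `l` -/
def SB {n : ℕ} (l : Fin n → ℤ) (f : LR n) (D : ℝ) : Prop :=
  ∀ m, f.coeff m ≠ 0 → -D ≤ (pr l m : ℝ)

lemma SB.mul {n : ℕ} {l : Fin n → ℤ} {f g : LR n} {D E : ℝ} (hf : SB l f D) (hg : SB l g E) :
    SB l (f * g) (D + E) := by
  intro m hm
  obtain ⟨a, b, ha, hb, rfl⟩ := coeff_mul_ne hm
  rw [pr_add]; push_cast
  linarith [hf a ha, hg b hb]

lemma SB.xm {n : ℕ} (l u : Fin n → ℤ) : SB l (xm u) (-(pr l u : ℝ)) := by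
  classical
  intro m hm
  rw [AddMonoidAlgebra.coeff_single, Finsupp.single_apply] at hm
  by_cases h : u = m
  · rw [h]; simp
  · simp [h] at hm

lemma SB.one {n : ℕ} (l : Fin n → ℤ) : SB l 1 0 := by
  have := SB.xm l 0
  simpa [pr, xm_zero] using this

lemma SB.pow {n : ℕ} {l : Fin n → ℤ} {f : LR n} {D : ℝ} (hf : SB l f D) (j : ℕ) :
    SB l (f ^ j) (j * D) := by
  induction j with
  | zero => simpa using SB.one l
  | succ j ih => rw [pow_succ]; push_cast; rw [add_mul, one_mul]; exact ih.mul hf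

lemma SB.prod {n : ℕ} {l : Fin n → ℤ} (A : Finset (Fin n → ℤ)) (f : (Fin n → ℤ) → LR n) {D : ℝ}
    (h : ∀ u ∈ A, SB l (f u) D) : SB l (∏ u ∈ A, f u) (A.card * D) := by
  classical
  induction A using Finset.induction_on with
  | empty => simpa using SB.one l
  | insert u A hu ih =>
    rw [Finset.prod_insert hu, Finset.card_insert_of_notMem hu]
    push_cast
    rw [add_mul, one_mul, add_comm]
    exact (h u (by simp)).mul (ih fun v hv => h v (by simp [hv]))

/-- sum of the coefficients with exponents divisible by `q` -/
noncomputable def Lq (n q : ℕ) : LR n →+ ZMod 2 := by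
  classical
  exact (Finsupp.liftAddHom (fun m : Fin n → ℤ =>
    if ∀ i, (q : ℤ) ∣ m i then AddMonoidHom.id (ZMod 2) else 0)).comp
    (AddMonoidAlgebra.coeffAddEquiv : LR n ≃+ _).toAddMonoidHom

open Classical in
lemma Lq_single {n q : ℕ} (m : Fin n → ℤ) (r : ZMod 2) :
    Lq n q (AddMonoidAlgebra.single m r) = if ∀ i, (q : ℤ) ∣ m i then r else 0 := by
  simp only [Lq, AddMonoidHom.comp_apply]
  change Finsupp.liftAddHom _ (Finsupp.single m r) = _
  rw [Finsupp.liftAddHom_apply_single]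
  split_ifs <;> simp

lemma Lq_eq_coeff {n q : ℕ} (f : LR n)
    (h : ∀ m, f.coeff m ≠ 0 → (∀ i, (q : ℤ) ∣ m i) → m = 0) : Lq n q f = f.coeff 0 := by
  classical
  conv_lhs => rw [← AddMonoidAlgebra.sum_coeff_single f]
  rw [Finsupp.sum, map_sum]
  simp only [Lq_single]
  rw [Finset.sum_eq_single 0]
  · simp
  · intro m hm hm0
    rw [if_neg]
    intro hd
    exact hm0 (h m (by simpa using hm) hd)
  · intro h0
    simpa using h0

/-- Frobenius power ideal -/
noncomputable def JJ (n q : ℕ) : Ideal (LR n) :=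
  Ideal.span (Set.range fun i : Fin n => (yy i : LR n) ^ q)

lemma yy_pow {n e : ℕ} (i : Fin n) :
    (yy i : LR n) ^ (2 ^ e) = xm (Pi.single i ((2 ^ e : ℕ) : ℤ)) - 1 := by
  have : CharP (LR n) 2 := charP_of_injective_algebraMap (algebraMap (ZMod 2) (LR n)).injective 2
  rw [yy, sub_pow_char_pow, one_pow, AddMonoidAlgebra.single_pow, ← Pi.single_smul]
  simp

lemma Lq_mul_gen {n e : ℕ} (i : Fin n) (f : LR n) :
    Lq n (2 ^ e) (f * (yy i) ^ (2 ^ e)) = 0 := by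
  classical
  rw [yy_pow, mul_sub, mul_one, map_sub, sub_eq_zero]
  induction f using AddMonoidAlgebra.induction_linear with
  | zero => simp
  | add f g hf hg => rw [add_mul, map_add, map_add, hf, hg]
  | single m r =>
    rw [AddMonoidAlgebra.single_mul_single, Lq_single, Lq_single, mul_one]
    congr 1
    refine propext (forall_congr' fun j => ?_)
    by_cases hj : j = i
    · subst hj; simp
    · simp [hj]

lemma Lq_JJ {n e : ℕ} {f : LR n} (hf : f ∈ JJ n (2 ^ e)) : Lq n (2 ^ e) f = 0 := by
  have : ∀ r : LR n, Lq n (2 ^ e) (r * f) = 0 := by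
    induction hf using Submodule.span_induction with
    | mem x hx => obtain ⟨i, rfl⟩ := hx; exact fun r => Lq_mul_gen i r
    | zero => simp
    | add x y _ _ hx hy => intro r; rw [mul_add, map_add, hx, hy, add_zero]
    | smul a x _ hx => intro r; rw [smul_eq_mul, ← mul_assoc]; exact hx _
  simpa using this 1

lemma II_pow_le {n q : ℕ} (hn : 1 ≤ n) : (II n) ^ (n * q) ≤ JJ n q := by
  classical
  have key : ∀ T : Finset (Fin n), T.Nonempty →
      (Ideal.span (yy '' (T : Set (Fin n))) : Ideal (LR n)) ^ (T.card * q) ≤ JJ n q := by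
    intro T hT
    have hs : ∀ i : Fin n, (Ideal.span {yy i} : Ideal (LR n)) ^ q ≤ JJ n q := by
      intro i
      rw [Ideal.span_singleton_pow, Ideal.span_singleton_le_iff_mem]
      exact Ideal.subset_span ⟨i, rfl⟩
    induction hT using Finset.Nonempty.cons_induction with
    | singleton i => simpa using hs i
    | cons i T hi hT ih =>
      rw [Finset.card_cons, add_mul, one_mul, Finset.coe_cons, Set.image_insert_eq,
        Ideal.span_insert, sup_comm]
      exact Ideal.sup_pow_add_le_pow_sup_pow.trans (sup_le ih (hs i))
  have : Nonempty (Fin n) := ⟨⟨0, hn⟩⟩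
  have := key Finset.univ Finset.univ_nonempty
  simpa [II] using this

theorem key_bound {n : ℕ} (hn : 1 ≤ n) {ι : Type} (s : Finset ι) (l : ι → Fin n → ℤ) (a : ι → ℝ)
    (ha : ∀ F ∈ s, 0 < a F ∧ a F ≤ 1)
    (hb : ∀ m : Fin n → ℤ, (∀ F ∈ s, 0 ≤ pr (l F) m) → m = 0)
    (G : LR n) (D : ℝ) (hD : 0 < D) (hlead : Lead G 0)
    (hsupp : ∀ F ∈ s, SB (l F) G (D * a F)) (M : ℕ) (hM : G ∈ (II n) ^ M) :
    (M : ℝ) ≤ n * D := by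
  by_contra! hlt
  have hn' : (1 : ℝ) ≤ n := by exact_mod_cast hn
  have hMpos : (0 : ℝ) < M := lt_trans (by positivity) hlt
  have hgap : 0 < 1 / D - n / M := by
    rw [sub_pos, div_lt_div_iff₀ hMpos hD]; linarith
  obtain ⟨e, he⟩ := pow_unbounded_of_one_lt (1 / (1 / D - n / M)) (one_lt_two (α := ℝ))
  set q : ℕ := 2 ^ e with hq
  have hqR : ((q : ℕ) : ℝ) = 2 ^ e := by simp [hq]
  rw [← hqR, div_lt_iff₀ hgap] at he
  have hqpos : (0 : ℝ) < q := by rw [hqR]; positivity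
  set j : ℕ := ⌈(n * q : ℝ) / M⌉₊ with hj
  have hj1 : (n * q : ℝ) / M ≤ j := Nat.le_ceil _
  have hj2 : (j : ℝ) < (n * q : ℝ) / M + 1 := Nat.ceil_lt_add_one (by positivity)
  have hj3 : n * q ≤ M * j := by
    rw [div_le_iff₀ hMpos] at hj1
    have : ((n * q : ℕ) : ℝ) ≤ ((M * j : ℕ) : ℝ) := by push_cast; linarith
    exact_mod_cast this
  have hj4 : (j : ℝ) * D < q := by
    rw [← lt_div_iff₀ hD]
    have : (q : ℝ) * (1 / D - n / M) = q / D - n * q / M := by ring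
    linarith
  have hmem : G ^ j ∈ JJ n q := by
    refine II_pow_le hn (Ideal.pow_le_pow_right hj3 ?_)
    rw [pow_mul]
    exact Ideal.pow_mem_pow hM j
  have h0 : Lq n q (G ^ j) = 0 := Lq_JJ hmem
  rw [Lq_eq_coeff] at h0
  · exact (hlead.pow j).1 h0
  · intro m hm hdvd
    choose m' hm' using hdvd
    have hmm : m = (q : ℤ) • m' := by funext i; simp [hm']
    have : m' = 0 := by
      apply hb
      intro F hF
      have h1 := (hsupp F hF).pow j m hm
      rw [hmm, pr_smul] at h1
      push_cast at h1
      have h2 : (j : ℝ) * (D * a F) < q := by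
        rw [← mul_assoc]
        have := mul_le_mul_of_nonneg_left (ha F hF).2 (show 0 ≤ (j : ℝ) * D by positivity)
        linarith
      have h3 : (-1 : ℝ) < pr (l F) m' := by
        by_contra! hc
        have := mul_le_mul_of_nonneg_left hc hqpos.le
        linarith
      have h4 : (-1 : ℤ) < pr (l F) m' := by exact_mod_cast h3
      omega
    rw [hmm, this, smul_zero]

/-- number of non-leading exponents -/
lemma card_nonlead_le {n : ℕ} (t : ℕ) (A B : Finset (Fin n → ℤ)) (hBA : B ⊆ A)
    (hB : ∀ u ∈ B, ¬ ∃ f : LR n, Lead f u ∧ (∀ m, f.coeff m ≠ 0 → m ∈ A) ∧ f ∈ (II n) ^ (t + 1)) :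
    B.card ≤ (n + t).choose n := by
  classical
  obtain ⟨hfin, hrank⟩ := finrank_quot_le (n := n) t
  refine le_trans ?_ hrank
  let v : B → (LR n ⧸ (II n) ^ (t + 1)) := fun u => Ideal.Quotient.mk _ (xm u.1)
  have hli : LinearIndependent (ZMod 2) v := by
    rw [Fintype.linearIndependent_iff]
    intro c hc
    by_contra! hne
    obtain ⟨i, hi⟩ := hne
    set f : LR n := ∑ u : B, c u • xm u.1 with hf
    have hcoeff : ∀ m, f.coeff m = ∑ u : B, if u.1 = m then c u else 0 := by
      intro m
      rw [hf, AddMonoidAlgebra.coeff_sum, Finsupp.finsetSum_apply]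
      refine Finset.sum_congr rfl fun u _ => ?_
      simp [Finsupp.single_apply]
    have hsupp : ∀ m, f.coeff m ≠ 0 → m ∈ B := by
      intro m hm
      rw [hcoeff] at hm
      obtain ⟨u, _, hu⟩ := Finset.exists_ne_zero_of_sum_ne_zero hm
      by_cases h : u.1 = m
      · rw [← h]; exact u.2
      · simp [h] at hu
    have hfi : f.coeff i.1 = c i := by
      rw [hcoeff, Finset.sum_eq_single i]
      · simp
      · intro b _ hb
        rw [if_neg]; exact fun h => hb (Subtype.ext h)
      · simp
    have hf0 : f ≠ 0 := by
      intro h; rw [h] at hfi; exact hi (by simpa using hfi.symm)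
    obtain ⟨u, hu⟩ := exists_lead hf0
    refine hB u (hsupp u hu.1) ⟨f, hu, fun m hm => hBA (hsupp m hm), ?_⟩
    rw [← Ideal.Quotient.eq_zero_iff_mem, ← hc, hf, map_sum]
    refine Finset.sum_congr rfl fun u _ => ?_
    exact map_smul (Ideal.Quotient.mkₐ (ZMod 2) ((II n) ^ (t + 1))) _ _
  have := hli.fintype_card_le_finrank
  simpa using this

theorem count_bound {n : ℕ} (hn : 1 ≤ n) {ι : Type} (s : Finset ι) (l : ι → Fin n → ℤ) (a : ι → ℝ)
    (ha : ∀ F ∈ s, 0 < a F ∧ a F ≤ 1)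
    (hb : ∀ m : Fin n → ℤ, (∀ F ∈ s, 0 ≤ pr (l F) m) → m = 0)
    (k T : ℕ) (hk : 1 ≤ k) (A : Finset (Fin n → ℤ)) (hA : A.Nonempty)
    (hAm : ∀ u ∈ A, ∀ F ∈ s, -(k * a F) ≤ (pr (l F) u : ℝ))
    (ε : ℝ) (hε : 0 ≤ ε)
    (hsum : ∀ F ∈ s, (pr (l F) (∑ u ∈ A, u) : ℝ) ≤ ε * (k * A.card) * a F) :
    (T : ℝ) * A.card - ((n + T).choose (n + 1) : ℕ) ≤ n * (k * A.card * (1 + ε)) := by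
  classical
  let good : (Fin n → ℤ) → ℕ → Prop := fun u t =>
    ∃ f : LR n, Lead f u ∧ (∀ m, f.coeff m ≠ 0 → m ∈ A) ∧ f ∈ (II n) ^ t
  have hgood0 : ∀ u ∈ A, good u 0 := by
    intro u hu
    refine ⟨xm u, Lead.xm u, ?_, by simp⟩
    intro m hm
    rw [AddMonoidAlgebra.coeff_single, Finsupp.single_apply] at hm
    by_cases h : u = m
    · rwa [← h]
    · simp [h] at hm
  let g : (Fin n → ℤ) → ℕ := fun u => Nat.findGreatest (good u) T
  have hg : ∀ u ∈ A, good u (g u) := fun u hu =>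
    Nat.findGreatest_spec (Nat.zero_le T) (hgood0 u hu)
  choose! f hf1 hf2 hf3 using hg
  -- sum of orders
  have hlow : T * A.card ≤ (∑ u ∈ A, g u) + (n + T).choose (n + 1) := by
    have h1 : ∀ u ∈ A, T ≤ g u + ((Finset.range T).filter (fun t => g u ≤ t)).card := by
      intro u _
      have : ((Finset.range T).filter (fun t => g u ≤ t)) = Finset.Ico (g u) T := by
        ext t; simp [and_comm]
      rw [this, Nat.card_Ico]; omega
    have h2 : ∀ t ∈ Finset.range T, (A.filter (fun u => g u ≤ t)).card ≤ (t + n).choose n := by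
      intro t ht
      rw [add_comm t n]
      refine card_nonlead_le t A _ (Finset.filter_subset _ _) ?_
      intro u hu hgd
      rw [Finset.mem_filter] at hu
      have := Nat.le_findGreatest (P := good u) (Nat.succ_le_of_lt (Finset.mem_range.1 ht)) hgd
      have h3 : g u ≤ t := hu.2
      change t + 1 ≤ g u at this
      omega
    have h3 : ∑ u ∈ A, ((Finset.range T).filter (fun t => g u ≤ t)).card
        = ∑ t ∈ Finset.range T, (A.filter (fun u => g u ≤ t)).card := by
      simp only [Finset.card_filter]
      exact Finset.sum_comm
    have h4 : ∑ t ∈ Finset.range T, (t + n).choose n = (n + T).choose (n + 1) := by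
      cases T with
      | zero => simp
      | succ T => rw [Nat.sum_range_add_choose]; congr 1; omega
    calc T * A.card = ∑ u ∈ A, T := by simp [mul_comm]
      _ ≤ ∑ u ∈ A, (g u + ((Finset.range T).filter (fun t => g u ≤ t)).card) :=
        Finset.sum_le_sum h1
      _ = (∑ u ∈ A, g u) + ∑ t ∈ Finset.range T, (A.filter (fun u => g u ≤ t)).card := by
        rw [Finset.sum_add_distrib, h3]
      _ ≤ _ := by
        rw [← h4]; exact Nat.add_le_add_left (Finset.sum_le_sum h2) _
  have hcard : (0 : ℝ) < A.card := by exact_mod_cast hA.card_pos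
  have hk' : (0 : ℝ) < k := by exact_mod_cast hk
  have hup : ((∑ u ∈ A, g u : ℕ) : ℝ) ≤ n * (k * A.card * (1 + ε)) := by
    refine key_bound hn s l a ha hb ((∏ u ∈ A, f u) * xm (-∑ u ∈ A, u)) _ (by positivity) ?_ ?_ _ ?_
    · have := (Lead.prod A f hf1).mul (Lead.xm (-∑ u ∈ A, u))
      rwa [add_neg_cancel] at this
    · intro F hF
      have h1 : SB (l F) (∏ u ∈ A, f u) (A.card * (k * a F)) :=
        SB.prod A f fun u hu m hm => hAm m (hf2 u hu m hm) F hF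
      have h2 := h1.mul (SB.xm (l F) (-∑ u ∈ A, u))
      intro m hm
      have h3 := h2 m hm
      rw [pr_neg] at h3
      push_cast at h3
      have h4 := hsum F hF
      nlinarith
    · refine Ideal.mul_mem_right _ _ ?_
      rw [← Finset.prod_pow_eq_pow_sum]
      exact Ideal.prod_mem_prod fun u hu => hf3 u hu
  have hlow' : (T : ℝ) * A.card ≤ ((∑ u ∈ A, g u : ℕ) : ℝ) + ((n + T).choose (n + 1) : ℕ) := by
    exact_mod_cast hlow
  linarith


open Filter Topology in
theorem limit_ineq {n : ℕ} (N : ℕ → ℕ) (V τ ε : ℝ) (hτ : 0 ≤ τ)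
    (hN : Tendsto (fun k : ℕ => (N k : ℝ) / (k : ℝ) ^ n) atTop (𝓝 V))
    (h : ∀ᶠ k : ℕ in atTop, ∀ T : ℕ,
      (T : ℝ) * N k - ((n + T).choose (n + 1) : ℕ) ≤ n * (k * N k * (1 + ε))) :
    τ * V - τ ^ (n + 1) / ((n + 1).factorial : ℝ) ≤ n * (V * (1 + ε)) := by
  have hT : Tendsto (fun k : ℕ => (⌊τ * (k : ℝ)⌋₊ : ℝ) / (k : ℝ)) atTop (𝓝 τ) :=
    (tendsto_nat_floor_mul_div_atTop hτ).comp tendsto_natCast_atTop_atTop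
  have hn0 : Tendsto (fun k : ℕ => (n : ℝ) / (k : ℝ)) atTop (𝓝 0) :=
    tendsto_const_div_atTop_nhds_zero_nat _
  have h1 : Tendsto (fun k : ℕ => (⌊τ * (k : ℝ)⌋₊ : ℝ) / (k : ℝ) * ((N k : ℝ) / (k : ℝ) ^ n)
      - ((n : ℝ) / k + (⌊τ * (k : ℝ)⌋₊ : ℝ) / (k : ℝ)) ^ (n + 1) / ((n + 1).factorial : ℝ)) atTop
      (𝓝 (τ * V - (0 + τ) ^ (n + 1) / ((n + 1).factorial : ℝ))) :=
    (hT.mul hN).sub (((hn0.add hT).pow (n + 1)).div_const _)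
  have h2 : Tendsto (fun k : ℕ => (n : ℝ) * (((N k : ℝ) / (k : ℝ) ^ n) * (1 + ε))) atTop
      (𝓝 (n * (V * (1 + ε)))) := (hN.mul_const _).const_mul _
  rw [zero_add] at h1
  refine le_of_tendsto_of_tendsto h1 h2 ?_
  filter_upwards [h, eventually_gt_atTop 0] with k hk hk0
  have hkR : (0 : ℝ) < k := by exact_mod_cast hk0
  have h3 := hk ⌊τ * (k : ℝ)⌋₊
  set T := ⌊τ * (k : ℝ)⌋₊
  have h4 : (((n + T).choose (n + 1) : ℕ) : ℝ) ≤ ((n : ℝ) + T) ^ (n + 1) / ((n + 1).factorial : ℝ) := by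
    have := Nat.choose_le_pow_div (α := ℝ) (n + 1) (n + T)
    simpa using this
  have e1 : (T : ℝ) / (k : ℝ) * ((N k : ℝ) / (k : ℝ) ^ n)
      - ((n : ℝ) / k + (T : ℝ) / (k : ℝ)) ^ (n + 1) / ((n + 1).factorial : ℝ)
      = (T * N k - ((n : ℝ) + T) ^ (n + 1) / ((n + 1).factorial : ℝ)) / (k : ℝ) ^ (n + 1) := by
    rw [← add_div, div_pow]
    field_simp
    ring
  have e2 : (n : ℝ) * (((N k : ℝ) / (k : ℝ) ^ n) * (1 + ε))
      = (n * (k * N k * (1 + ε))) / (k : ℝ) ^ (n + 1) := by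
    field_simp
    ring
  rw [e1, e2]
  gcongr
  linarith

theorem final_ineq {n : ℕ} (hn : 1 ≤ n) (V : ℝ) (hV : 0 < V)
    (h : ∀ τ ε : ℝ, 0 ≤ τ → 0 < ε →
      τ * V - τ ^ (n + 1) / ((n + 1).factorial : ℝ) ≤ n * (V * (1 + ε))) :
    V ≤ ((n : ℝ) + 1) ^ n / (n.factorial : ℝ) := by
  have hf : (0 : ℝ) < n.factorial := by exact_mod_cast n.factorial_pos
  have hn' : (0 : ℝ) < n := by exact_mod_cast hn
  set τ : ℝ := (n.factorial * V) ^ ((n : ℝ)⁻¹) with hτ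
  have hτ0 : 0 ≤ τ := by positivity
  have hτn : τ ^ n = n.factorial * V :=
    Real.rpow_inv_natCast_pow (by positivity) (by omega)
  have h1 : τ * V - τ ^ (n + 1) / ((n + 1).factorial : ℝ) ≤ n * V := by
    refine le_of_forall_pos_le_add fun δ hδ => ?_
    have := h τ (δ / (n * V)) hτ0 (by positivity)
    refine this.trans (le_of_eq ?_)
    field_simp
  have h2 : τ * V - τ ^ (n + 1) / ((n + 1).factorial : ℝ) = τ * V * (n / (n + 1)) := by
    rw [pow_succ, hτn, Nat.factorial_succ]
    push_cast
    field_simp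
    ring
  rw [h2] at h1
  have h3 : τ ≤ n + 1 := by
    have h4 : τ * V * (n / (n + 1)) = τ * (n * V) / (n + 1) := by ring
    rw [h4, div_le_iff₀ (by positivity)] at h1
    have : 0 < n * V := by positivity
    by_contra! hc
    nlinarith
  rw [le_div_iff₀ hf, mul_comm, ← hτn]
  gcongr

/-- rescaled lattice point -/
noncomputable def ph {n : ℕ} (k : ℕ) (u : Fin n → ℤ) : Fin n → ℝ := fun i => (u i : ℝ) / k

lemma finite_pts {n : ℕ} (P : Set (Fin n → ℝ)) (hP : Bornology.IsBounded P) (k : ℕ) (hk : 0 < k) :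
    {u : Fin n → ℤ | ph k u ∈ P}.Finite := by
  obtain ⟨R, hR⟩ := hP.exists_norm_le
  have hkR : (0 : ℝ) < k := by exact_mod_cast hk
  refine (Set.finite_Icc (fun _ : Fin n => -⌈R * k⌉) (fun _ : Fin n => ⌈R * k⌉)).subset ?_
  intro u hu
  have h1 := hR _ hu
  have h2 : ∀ i, |(u i : ℝ)| ≤ ⌈R * k⌉ := by
    intro i
    have h3 := (norm_le_pi_norm (ph k u) i).trans h1
    rw [Real.norm_eq_abs, ph, abs_div, Nat.abs_cast, div_le_iff₀ hkR] at h3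
    exact h3.trans (Int.le_ceil _)
  constructor <;> intro i
  · have := (abs_le.1 (h2 i)).1; exact_mod_cast this
  · have := (abs_le.1 (h2 i)).2; exact_mod_cast this

lemma tsum_pts {n : ℕ} (P : Set (Fin n → ℝ)) (k : ℕ) (hk : 0 < k)
    (hfin : {u : Fin n → ℤ | ph k u ∈ P}.Finite) (F : (Fin n → ℝ) → ℝ) :
    (∑' x : ↑(P ∩ (k : ℝ)⁻¹ • (Submodule.span ℤ (Set.range (Pi.basisFun ℝ (Fin n))) : Set (Fin n → ℝ))), F x)
      = ∑ u ∈ hfin.toFinset, F (ph k u) := by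
  have hkR : (0 : ℝ) < k := by exact_mod_cast hk
  have hinj : Function.Injective (ph k : (Fin n → ℤ) → Fin n → ℝ) := by
    intro u v h
    funext i
    have := congrFun h i
    simp only [ph] at this
    field_simp at this
    exact_mod_cast this
  have hset : P ∩ (k : ℝ)⁻¹ • (Submodule.span ℤ (Set.range (Pi.basisFun ℝ (Fin n))) : Set (Fin n → ℝ))
      = ph k '' {u : Fin n → ℤ | ph k u ∈ P} := by
    have : NeZero k := ⟨hk.ne'⟩
    ext x
    constructor
    · rintro ⟨hx, hx2⟩
      have h3 := (BoxIntegral.unitPartition.mem_smul_span_iff (n := k) (v := x)).1 hx2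
      choose z hz using h3
      have : ph k z = x := by
        funext i
        have hzi := hz i
        simp only [ph]
        rw [div_eq_iff hkR.ne']
        simp at hzi
        linarith
      exact ⟨z, by simpa [this] using hx, this⟩
    · rintro ⟨u, hu, rfl⟩
      refine ⟨hu, ?_⟩
      refine (BoxIntegral.unitPartition.mem_smul_span_iff (n := k)).2 fun i => ⟨u i, ?_⟩
      simp [ph]
      field_simp
  rw [hset, tsum_image F hinj.injOn]
  have := Finset.tsum_subtype' hfin.toFinset (fun u => F (ph k u))
  rw [hfin.coe_toFinset] at this
  exact this

end ToricVol

open ToricVol Filter Topology in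
/-- If `P ⊆ ℝⁿ` (`n ≥ 1`) is a compact set with nonempty interior of the
form `P = {x : ⟨l_F, x⟩ ≥ -a_F, F ∈ s}`, where each `l_F ∈ ℤⁿ` is a primitive lattice
vector and each `a_F ∈ ℚ` satisfies `0 < a_F ≤ 1`, and the barycenter of `P` is the
origin, then `Vol(P) ≤ (n+1)ⁿ/n!`. -/
theorem volume_le_of_polytope_barycenter_zero (n : ℕ) (hn : 1 ≤ n)
    (ι : Type) (s : Finset ι) (l : ι → Fin n → ℤ) (a : ι → ℚ)
    (hprim : ∀ F ∈ s, Finset.univ.gcd (fun i => (l F i).natAbs) = 1)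
    (ha : ∀ F ∈ s, 0 < a F ∧ a F ≤ 1)
    (P : Set (Fin n → ℝ))
    (hP : P = {x : Fin n → ℝ | ∀ F ∈ s, -(a F : ℝ) ≤ ∑ i, (l F i : ℝ) * x i})
    (hcomp : IsCompact P) (hint : (interior P).Nonempty)
    (hbar : ∫ x in P, x = 0) :
    (volume P).toReal ≤ ((n : ℝ) + 1) ^ n / (n.factorial : ℝ) := by
  have ha' : ∀ F ∈ s, 0 < (a F : ℝ) ∧ (a F : ℝ) ≤ 1 := fun F hF =>
    ⟨by exact_mod_cast (ha F hF).1, by exact_mod_cast (ha F hF).2⟩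
  have hmemP : ∀ x, x ∈ P ↔ ∀ F ∈ s, -(a F : ℝ) ≤ ∑ i, (l F i : ℝ) * x i := by
    intro x; rw [hP]; rfl
  have hconv : Convex ℝ P := by
    intro x hx y hy b c hb hc hbc
    rw [hmemP] at hx hy ⊢
    intro F hF
    have e : ∑ i, (l F i : ℝ) * (b • x + c • y) i
        = b * (∑ i, (l F i : ℝ) * x i) + c * ∑ i, (l F i : ℝ) * y i := by
      rw [Finset.mul_sum, Finset.mul_sum, ← Finset.sum_add_distrib]
      refine Finset.sum_congr rfl fun i _ => ?_
      simp only [Pi.add_apply, Pi.smul_apply, smul_eq_mul]; ring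
    rw [e]
    have h1 := mul_le_mul_of_nonneg_left (hx F hF) hb
    have h2 := mul_le_mul_of_nonneg_left (hy F hF) hc
    have h3 : (a F : ℝ) = b * a F + c * a F := by rw [← add_mul, hbc, one_mul]
    linarith
  have hbdd := hcomp.isBounded
  have hfront : volume (frontier P) = 0 := hconv.addHaar_frontier volume
  have hV : 0 < (volume P).toReal := by
    refine ENNReal.toReal_pos ?_ hcomp.measure_lt_top.ne
    exact (Measure.measure_pos_of_nonempty_interior volume hint).ne'
  have hb : ∀ m : Fin n → ℤ, (∀ F ∈ s, 0 ≤ pr (l F) m) → m = 0 := by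
    intro m hm
    obtain ⟨R, hR⟩ := hbdd.exists_norm_le
    have hR0 : 0 ≤ R := by
      obtain ⟨x, hx⟩ := hint
      exact (norm_nonneg x).trans (hR x (interior_subset hx))
    funext i
    by_contra hi
    have hmem : (fun j => (R + 1) * (m j : ℝ)) ∈ P := by
      rw [hmemP]
      intro F hF
      have e : ∑ j, (l F j : ℝ) * ((R + 1) * (m j : ℝ)) = (R + 1) * (pr (l F) m : ℝ) := by
        rw [pr]; push_cast; rw [Finset.mul_sum]
        exact Finset.sum_congr rfl fun i _ => by ring
      rw [e]
      have h1 : (0 : ℝ) ≤ pr (l F) m := by exact_mod_cast hm F hF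
      have h2 := (ha' F hF).1
      have : 0 ≤ (R + 1) * (pr (l F) m : ℝ) := by positivity
      linarith
    have h1 := (norm_le_pi_norm _ i).trans (hR _ hmem)
    rw [Real.norm_eq_abs, abs_mul, abs_of_pos (by linarith : 0 < R + 1)] at h1
    have h2 : (1 : ℝ) ≤ |(m i : ℝ)| := by
      have : (1 : ℤ) ≤ |m i| := Int.one_le_abs hi
      exact_mod_cast this
    nlinarith
  -- lattice points
  have hfin : ∀ k : ℕ, 0 < k → {u : Fin n → ℤ | ph k u ∈ P}.Finite := fun k hk =>
    finite_pts P hbdd k hk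
  classical
  let A : ℕ → Finset (Fin n → ℤ) := fun k => if hk : 0 < k then (hfin k hk).toFinset else ∅
  have hA : ∀ k, 0 < k → ∀ u, u ∈ A k ↔ ph k u ∈ P := by
    intro k hk u
    simp only [A, dif_pos hk, Set.Finite.mem_toFinset, Set.mem_ofPred_eq]
  have hlim : ∀ F : (Fin n → ℝ) → ℝ, Continuous F →
      Tendsto (fun k : ℕ => (∑ u ∈ A k, F (ph k u)) / (k : ℝ) ^ n) atTop (𝓝 (∫ x in P, F x)) := by
    intro F hF
    have := tendsto_tsum_div_pow_atTop_integral P F hF hbdd hcomp.measurableSet hfront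
    rw [Fintype.card_fin] at this
    refine this.congr' ?_
    filter_upwards [eventually_gt_atTop 0] with k hk
    rw [tsum_pts P k hk (hfin k hk) F]
    simp only [A, dif_pos hk]
  have hN : Tendsto (fun k : ℕ => ((A k).card : ℝ) / (k : ℝ) ^ n) atTop
      (𝓝 (volume P).toReal) := by
    have := hlim (fun _ => 1) continuous_const
    simpa [measureReal_def] using this
  have hphpr : ∀ k : ℕ, 0 < k → ∀ F (u : Fin n → ℤ),
      ∑ i, (l F i : ℝ) * ph k u i = (pr (l F) u : ℝ) / k := by
    intro k hk F u
    rw [pr]; push_cast; rw [Finset.sum_div]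
    exact Finset.sum_congr rfl fun i _ => by simp only [ph]; ring
  have hmom : ∀ F, Tendsto (fun k : ℕ => (pr (l F) (∑ u ∈ A k, u) : ℝ) / k / (k : ℝ) ^ n) atTop
      (𝓝 0) := by
    intro F
    have h1 := hlim (fun x => ∑ i, (l F i : ℝ) * x i) (by fun_prop)
    have h2 : ∫ x in P, ∑ i, (l F i : ℝ) * x i = 0 := by
      let Φ : (Fin n → ℝ) →L[ℝ] ℝ :=
        ∑ i, (l F i : ℝ) • ContinuousLinearMap.proj (R := ℝ) (φ := fun _ : Fin n => ℝ) i
      have hint' : Integrable (fun x : Fin n → ℝ => x) (volume.restrict P) :=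
        continuous_id.continuousOn.integrableOn_compact hcomp
      have h3 := Φ.integral_comp_comm hint'
      rw [hbar, map_zero] at h3
      rw [← h3]
      refine integral_congr_ae (Eventually.of_forall fun x => ?_)
      simp [Φ]
    rw [h2] at h1
    refine h1.congr' ?_
    filter_upwards [eventually_gt_atTop 0] with k hk
    congr 1
    simp only [hphpr k hk]
    rw [← Finset.sum_div]
    congr 1
    have : ∀ B : Finset (Fin n → ℤ), pr (l F) (∑ u ∈ B, u) = ∑ u ∈ B, pr (l F) u := by
      intro B
      induction B using Finset.induction_on with
      | empty => simp [pr]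
      | insert u B hu ih => rw [Finset.sum_insert hu, Finset.sum_insert hu, pr_add, ih]
    rw [this]; push_cast; rfl
  refine final_ineq hn _ hV fun τ ε hτ hε => ?_
  refine limit_ineq (fun k => (A k).card) _ τ ε hτ hN ?_
  have hev : ∀ᶠ k : ℕ in atTop, ∀ F ∈ s,
      (pr (l F) (∑ u ∈ A k, u) : ℝ) ≤ ε * (k * (A k).card) * a F := by
    rw [Filter.eventually_all_finset]
    intro F hF
    have h1 : Tendsto (fun k : ℕ => ε * (((A k).card : ℝ) / (k : ℝ) ^ n) * a F) atTop
        (𝓝 (ε * (volume P).toReal * a F)) := (hN.const_mul ε).mul_const _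
    have hpos : 0 < ε * (volume P).toReal * a F := mul_pos (mul_pos hε hV) (ha' F hF).1
    filter_upwards [(hmom F).eventually_lt h1 hpos, eventually_gt_atTop 0] with k hk hk0
    have hkR : (0 : ℝ) < k := by exact_mod_cast hk0
    generalize ((A k).card : ℝ) = c at hk ⊢
    have e : ε * (c / (k : ℝ) ^ n) * a F
        = (ε * (k * c) * a F) / k / (k : ℝ) ^ n := by
      field_simp
    rw [e] at hk
    rw [div_lt_div_iff_of_pos_right (by positivity), div_lt_div_iff_of_pos_right hkR] at hk
    exact hk.le
  filter_upwards [hev, eventually_gt_atTop 0, hN.eventually (lt_mem_nhds hV)] with k hk hk0 hkN T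
  have hkR : (0 : ℝ) < k := by exact_mod_cast hk0
  have hne : (A k).Nonempty := by
    rw [Finset.nonempty_iff_ne_empty]
    intro h
    rw [h] at hkN
    simp at hkN
  refine count_bound hn s l (fun F => (a F : ℝ)) ha' hb k T hk0 (A k) hne ?_ ε hε.le hk
  intro u hu F hF
  have h1 := (hmemP _).1 ((hA k hk0 u).1 hu) F hF
  rw [hphpr k hk0, le_div_iff₀ hkR] at h1
  linarith
end

section
/- Let n ≥ 1 and let P ⊆ ℝⁿ be a reflexive lattice polytope, i.e. P is the convex hull of a finite subset of ℤⁿ, P contains 0 in its interior, and the polar dual P* = {y ∈ ℝⁿ : ⟨y, x⟩ ≤ 1 for all x ∈ P} is also the convex hull of a finite subset of ℤⁿ. If the barycenter of P is the origin, then Vol(P) ≤ (n+1)ⁿ/n!. -/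
open MeasureTheory

lemma aux_int (s : ℝ) (n : ℕ) :
    ∫⁻ t in Set.Ici (0:ℝ), ENNReal.ofReal (s - t) ^ (n+1) / ((n+1).factorial : ENNReal)
      ≤ ENNReal.ofReal s ^ (n+2) / ((n+2).factorial : ENNReal) := by
  have hfac : ∀ m : ℕ, (m.factorial : ENNReal) = ENNReal.ofReal (m.factorial : ℝ) := by
    intro m; simp
  have hpos : ∀ m : ℕ, (0:ℝ) < (m.factorial : ℝ) := fun m => by exact_mod_cast m.factorial_pos
  rcases le_or_gt s 0 with hs | hs
  · have : ∫⁻ t in Set.Ici (0:ℝ), ENNReal.ofReal (s - t) ^ (n+1) / ((n+1).factorial : ENNReal)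
        = ∫⁻ t in Set.Ici (0:ℝ), 0 := by
      apply setLIntegral_congr_fun measurableSet_Ici
      intro t ht
      have : s - t ≤ 0 := by have : 0 ≤ t := ht; linarith
      simp [ENNReal.ofReal_of_nonpos this]
    rw [this]; simp
  · have h1 : ∫⁻ t in Set.Ici (0:ℝ), ENNReal.ofReal (s - t) ^ (n+1) / ((n+1).factorial : ENNReal)
        ≤ ∫⁻ t in Set.Ioc 0 s, ENNReal.ofReal ((s - t)^(n+1) / ((n+1).factorial : ℝ)) := by
      rw [setLIntegral_congr Ioi_ae_eq_Ici.symm, ← lintegral_indicator measurableSet_Ioi,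
        ← lintegral_indicator measurableSet_Ioc]
      apply lintegral_mono
      intro t
      by_cases ht : 0 < t
      · by_cases hts : t ≤ s
        · have h3 : 0 ≤ s - t := by linarith
          rw [Set.indicator_of_mem (show t ∈ Set.Ioi 0 from ht),
            Set.indicator_of_mem (show t ∈ Set.Ioc 0 s from ⟨ht, hts⟩),
            ENNReal.ofReal_div_of_pos (hpos _), ENNReal.ofReal_pow h3, hfac]
        · have h3 : s - t ≤ 0 := by linarith
          rw [Set.indicator_of_mem (show t ∈ Set.Ioi 0 from ht)]
          simp [ENNReal.ofReal_of_nonpos h3]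
      · rw [Set.indicator_of_notMem (by simpa using ht)]
        simp
    refine h1.trans ?_
    have hcont : Continuous (fun t : ℝ => (s - t)^(n+1) / ((n+1).factorial : ℝ)) := by fun_prop
    rw [← ofReal_integral_eq_lintegral_ofReal (hcont.integrableOn_Ioc),
      ← intervalIntegral.integral_of_le hs.le]
    · have : ∫ t in (0:ℝ)..s, (s - t)^(n+1) / ((n+1).factorial : ℝ)
          = s^(n+2) / ((n+2).factorial : ℝ) := by
        rw [intervalIntegral.integral_div,
          intervalIntegral.integral_comp_sub_left (fun t => t^(n+1)) s]
        rw [integral_pow, Nat.factorial_succ (n+1)]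
        have := hpos (n+1)
        push_cast
        simp only [sub_self, sub_zero]
        field_simp
        simp
      rw [this, ENNReal.ofReal_div_of_pos (hpos _), ENNReal.ofReal_pow hs.le, hfac]
    · rw [Filter.EventuallyLE, ae_restrict_iff' measurableSet_Ioc]
      refine Filter.Eventually.of_forall fun t ht => ?_
      have : 0 ≤ s - t := by linarith [ht.2]
      have := hpos (n+1)
      simp only [Pi.zero_apply]
      positivity

lemma aux_simplex (n : ℕ) : ∀ s : ℝ,
    ∫⁻ x, ENNReal.ofReal (s - ∑ i, x i)
      ∂(Measure.pi (fun _ : Fin n => (volume : Measure ℝ).restrict (Set.Ici 0)))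
      ≤ ENNReal.ofReal s ^ (n+1) / ((n+1).factorial : ENNReal) := by
  induction n with
  | zero => intro s; simp [Measure.pi_of_empty]
  | succ n ih =>
    intro s
    have hmp := measurePreserving_piFinSuccAbove
      (fun _ : Fin (n+1) => (volume : Measure ℝ).restrict (Set.Ici 0)) 0
    have h2 := hmp.lintegral_comp (f := fun p : ℝ × (Fin n → ℝ) =>
      ENNReal.ofReal (s - p.1 - ∑ i, p.2 i)) (by fun_prop)
    have h3 : ∀ x : Fin (n+1) → ℝ, ENNReal.ofReal (s - ∑ i, x i) =
        ENNReal.ofReal (s - ((MeasurableEquiv.piFinSuccAbove (fun _ => ℝ) 0) x).1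
          - ∑ i, ((MeasurableEquiv.piFinSuccAbove (fun _ => ℝ) 0) x).2 i) := by
      intro x
      congr 1
      rw [Fin.sum_univ_succ]
      simp [MeasurableEquiv.piFinSuccAbove, Fin.tail]
      ring
    simp_rw [h3]
    rw [h2, lintegral_prod _ (by fun_prop)]
    refine le_trans (lintegral_mono fun t => ih (s - t)) ?_
    exact aux_int s n

lemma aux_matrix (n : ℕ) (P : Set (Fin n → ℝ)) (hPc : IsCompact P) (W : Finset (Fin n → ℤ))
    (hdual : {y : Fin n → ℝ | ∀ x ∈ P, ∑ i, y i * x i ≤ 1}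
      = convexHull ℝ ((fun v : Fin n → ℤ => fun i => (v i : ℝ)) '' ↑W)) :
    ∃ N : Matrix (Fin n) (Fin n) ℤ, N.det ≠ 0 ∧ ∀ i, N i ∈ W := by
  classical
  set S : Set (Fin n → ℝ) := (fun v : Fin n → ℤ => fun i => (v i : ℝ)) '' ↑W with hS
  have hspan : Submodule.span ℝ S = ⊤ := by
    obtain ⟨C, hC⟩ := hPc.isBounded.exists_norm_le
    have hC' : ∀ x ∈ P, ∀ i, x i ≤ |C| + 1 := fun x hx i => by
      have h1 := norm_le_pi_norm x i
      have h2 := hC x hx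
      have h3 := le_abs_self C
      have h4 := le_abs_self (x i)
      rw [Real.norm_eq_abs] at h1
      linarith
    have hpos : 0 < |C| + 1 := by positivity
    have key : ∀ i, (Pi.single i 1 : Fin n → ℝ) ∈ Submodule.span ℝ S := by
      intro i
      have h1 : (Pi.single i (|C|+1)⁻¹ : Fin n → ℝ) ∈ convexHull ℝ S := by
        rw [← hdual]
        intro x hx
        simp only [Pi.single_apply, ite_mul, zero_mul, Finset.sum_ite_eq', Finset.mem_univ,
          if_true]
        rw [inv_mul_le_iff₀ hpos]
        linarith [hC' x hx i]
      have h2 := convexHull_min Submodule.subset_span (Submodule.span ℝ S).convex h1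
      have h3 := (Submodule.span ℝ S).smul_mem (|C|+1) h2
      rw [← Pi.single_smul'] at h3
      simpa [hpos.ne'] using h3
    rw [eq_top_iff]
    intro x _
    rw [pi_eq_sum_univ' x]
    exact Submodule.sum_mem _ fun i _ => by
      have := (Submodule.span ℝ S).smul_mem (x i) (key i)
      convert this using 2
  obtain ⟨b, hbS, hbspan, hbli⟩ := exists_linearIndependent ℝ S
  let B := Module.Basis.mk hbli (by rw [Subtype.range_coe, hbspan, hspan])
  have : Fintype b := FiniteDimensional.fintypeBasisIndex B
  have hcard : Fintype.card b = Fintype.card (Fin n) := by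
    rw [← Module.finrank_eq_card_basis B]; simp
  let e := (Fintype.equivOfCardEq hcard).symm
  have hex : ∀ i : Fin n, ∃ w ∈ W, (fun j => ((w j : ℤ) : ℝ)) = (e i : Fin n → ℝ) := by
    intro i
    obtain ⟨w, hw, h⟩ := hbS (e i).2
    exact ⟨w, hw, h⟩
  choose N hN hNe using hex
  refine ⟨Matrix.of N, ?_, hN⟩
  intro hdet
  have hli : LinearIndependent ℝ (fun i => (e i : Fin n → ℝ)) := hbli.comp e e.injective
  have hM : (fun i => (e i : Fin n → ℝ)) = ((Matrix.of N).map (Int.cast : ℤ → ℝ)).row := by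
    ext i j
    rw [← hNe]; simp
  rw [hM, Matrix.linearIndependent_rows_iff_isUnit, Matrix.isUnit_iff_isUnit_det] at hli
  have h5 : ((Matrix.of N).map (Int.cast : ℤ → ℝ)).det = (((Matrix.of N).det : ℤ) : ℝ) := by
    exact (RingHom.map_det (Int.castRingHom ℝ) (Matrix.of N)).symm
  rw [h5, hdet] at hli
  simp at hli

/-- A reflexive lattice polytope `P ⊆ ℝⁿ` (`n ≥ 1`) — i.e. `P` is the
convex hull of finitely many lattice points, `0` lies in its interior, and its polar
dual is again the convex hull of finitely many lattice points — whose barycenter is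
the origin satisfies `Vol(P) ≤ (n+1)ⁿ/n!`. -/
theorem volume_le_of_reflexive_barycenter_zero (n : ℕ) (hn : 1 ≤ n)
    (P : Set (Fin n → ℝ)) (V : Finset (Fin n → ℤ))
    (hP : P = convexHull ℝ ((fun v : Fin n → ℤ => fun i => (v i : ℝ)) '' ↑V))
    (h0 : (0 : Fin n → ℝ) ∈ interior P)
    (W : Finset (Fin n → ℤ))
    (hdual : {y : Fin n → ℝ | ∀ x ∈ P, ∑ i, y i * x i ≤ 1}
      = convexHull ℝ ((fun v : Fin n → ℤ => fun i => (v i : ℝ)) '' ↑W))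
    (hbar : ∫ x in P, x = 0) :
    (volume P).toReal ≤ ((n : ℝ) + 1) ^ n / (n.factorial : ℝ) := by
  have hPc : IsCompact P := by
    rw [hP]; exact (V.finite_toSet.image _).isCompact_convexHull (𝕜 := ℝ)
  obtain ⟨N, hdet, hNW⟩ := aux_matrix n P hPc W hdual
  set M : Matrix (Fin n) (Fin n) ℝ := N.map (Int.cast : ℤ → ℝ) with hM
  have hdetM : M.det = ((N.det : ℤ) : ℝ) :=
    (RingHom.map_det (Int.castRingHom ℝ) N).symm
  have hdetM0 : M.det ≠ 0 := by rw [hdetM]; exact_mod_cast hdet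
  have hdet1 : |M.det⁻¹| ≤ 1 := by
    rw [abs_inv]
    apply inv_le_one_of_one_le₀
    rw [hdetM]
    exact_mod_cast Int.one_le_abs hdet
  have hle : ∀ x ∈ P, ∀ i, M.toLin' x i ≤ 1 := by
    intro x hx i
    have h1 : (fun j => (N i j : ℝ)) ∈ {y : Fin n → ℝ | ∀ x ∈ P, ∑ i, y i * x i ≤ 1} := by
      rw [hdual]
      exact subset_convexHull ℝ _ ⟨N i, hNW i, rfl⟩
    have := h1 x hx
    simpa [Matrix.toLin'_apply, Matrix.mulVec, dotProduct, hM] using this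
  have hfin : volume P ≠ ⊤ := hPc.measure_lt_top.ne
  -- the linear functional
  let φ : (Fin n → ℝ) →L[ℝ] ℝ :=
    LinearMap.toContinuousLinearMap ((∑ i, LinearMap.proj i) ∘ₗ M.toLin')
  have hφ : ∀ x, φ x = ∑ i, M.toLin' x i := by
    intro x; simp [φ]
  have hidI : Integrable (fun x : Fin n → ℝ => x) (volume.restrict P) :=
    (continuous_id.continuousOn.integrableOn_compact hPc)
  have hφI : Integrable (fun x : Fin n → ℝ => φ x) (volume.restrict P) :=
    (φ.continuous.continuousOn.integrableOn_compact hPc)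
  have h1I : Integrable (fun _ : Fin n → ℝ => (1:ℝ)) (volume.restrict P) :=
    (continuous_const.continuousOn.integrableOn_compact hPc)
  have hvolInt : ∫ x in P, (1 + φ x) = (volume P).toReal := by
    rw [integral_add h1I hφI, φ.integral_comp_comm hidI, hbar]
    simp [Measure.real]
  -- positive function on the orthant
  let h : (Fin n → ℝ) → ENNReal := fun y =>
    (Set.univ.pi fun _ : Fin n => Set.Ici (0:ℝ)).indicator
      (fun y => ENNReal.ofReal ((n:ℝ) + 1 - ∑ i, y i)) y
  have hms : MeasurableSet (Set.univ.pi fun _ : Fin n => Set.Ici (0:ℝ)) :=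
    MeasurableSet.univ_pi fun _ => measurableSet_Ici
  have hmeas : Measurable h := Measurable.indicator (by fun_prop) hms
  have hh : ∫⁻ y, h y ≤ ENNReal.ofReal ((n:ℝ)+1) ^ (n+1) / ((n+1).factorial : ENNReal) := by
    rw [lintegral_indicator hms, volume_pi, Measure.restrict_pi_pi]
    exact aux_simplex n _
  have hup : ∫⁻ x in P, ENNReal.ofReal (1 + φ x) ≤ ∫⁻ y, h y := by
    calc ∫⁻ x in P, ENNReal.ofReal (1 + φ x)
        ≤ ∫⁻ x in P, h (1 - M.toLin' x) := by
          apply setLIntegral_mono' hPc.measurableSet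
          intro x hx
          have hmem : (1 - M.toLin' x) ∈ (Set.univ.pi fun _ : Fin n => Set.Ici (0:ℝ)) := by
            intro i _
            have := hle x hx i
            simp only [Set.mem_Ici, Pi.sub_apply, Pi.one_apply]
            linarith
          simp only [h]
          rw [Set.indicator_of_mem hmem, hφ]
          apply le_of_eq
          congr 1
          simp only [Pi.sub_apply, Pi.one_apply, Finset.sum_sub_distrib]
          simp
      _ ≤ ∫⁻ x, h (1 - M.toLin' x) := setLIntegral_le_lintegral _ _
      _ = ∫⁻ y, h (1 - y) ∂(Measure.map M.toLin' volume) := by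
          rw [lintegral_map]
          · exact hmeas.comp (by fun_prop)
          · exact (LinearMap.continuous_of_finiteDimensional _).measurable
      _ = ENNReal.ofReal |M.det⁻¹| * ∫⁻ y, h (1 - y) := by
          rw [Real.map_matrix_volume_pi_eq_smul_volume_pi hdetM0, lintegral_smul_measure]
          rfl
      _ ≤ 1 * ∫⁻ y, h (1 - y) := by
          gcongr
          exact ENNReal.ofReal_le_one.2 hdet1
      _ = ∫⁻ y, h y := by
          rw [one_mul, lintegral_sub_left_eq_self]
  have htot := hup.trans hh
  have hfacpos : (0:ℝ) < ((n+1).factorial : ℝ) := by exact_mod_cast (n+1).factorial_pos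
  have hRHS : ENNReal.ofReal ((n:ℝ)+1) ^ (n+1) / ((n+1).factorial : ENNReal)
      = ENNReal.ofReal (((n:ℝ)+1)^n / (n.factorial : ℝ)) := by
    have h1 : (((n+1).factorial : ℕ) : ENNReal) = ENNReal.ofReal ((n+1).factorial : ℝ) := by simp
    rw [h1, ← ENNReal.ofReal_pow (by positivity), ← ENNReal.ofReal_div_of_pos hfacpos]
    congr 1
    rw [Nat.factorial_succ]
    have : (0:ℝ) < (n.factorial : ℝ) := by exact_mod_cast n.factorial_pos
    push_cast
    field_simp
    ring
  rw [hRHS] at htot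
  rw [← hvolInt]
  have hpp := integral_eq_lintegral_pos_part_sub_lintegral_neg_part (h1I.add hφI)
  have h6 : ∫ x in P, (1 + φ x) ≤ (∫⁻ x in P, ENNReal.ofReal (1 + φ x)).toReal := by
    have := ENNReal.toReal_nonneg (a := ∫⁻ x in P, ENNReal.ofReal (-(1 + φ x)))
    simp only [Pi.add_apply] at hpp
    linarith
  exact h6.trans (ENNReal.toReal_le_of_le_ofReal (by positivity) htot)
end

section
/- Let n ≥ 1 and let Q ⊆ ℝⁿ be a lattice polytope (convex hull of a finite subset of ℤⁿ) containing 0 in its interior, and let P = Q* = {y ∈ ℝⁿ : ⟨y, x⟩ ≤ 1 for all x ∈ Q} be its polar dual. If the barycenter of P is the origin, then Vol(P) ≤ (n+1)ⁿ/n!. -/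
open MeasureTheory

/-- One-dimensional integral. -/
lemma lintegral_one_dim (m : ℕ) (c : ℝ) :
    ∫⁻ x : ℝ, (if 0 ≤ x then ENNReal.ofReal (max (c - x) 0 ^ (m + 1) / ((m + 1).factorial : ℝ)) else 0)
      ≤ ENNReal.ofReal (max c 0 ^ (m + 2) / ((m + 2).factorial : ℝ)) := by
  rcases le_or_gt c 0 with hc | hc
  · have : ∀ x : ℝ, (if 0 ≤ x then ENNReal.ofReal
        (max (c - x) 0 ^ (m + 1) / ((m + 1).factorial : ℝ)) else 0) = 0 := by
      intro x
      split_ifs with hx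
      · rw [max_eq_right (by linarith)]; simp
      · rfl
    simp [this]
  · have h1 : ∀ x : ℝ, (if 0 ≤ x then ENNReal.ofReal
        (max (c - x) 0 ^ (m + 1) / ((m + 1).factorial : ℝ)) else 0) =
        (Set.Icc 0 c).indicator (fun x => ENNReal.ofReal
          ((c - x) ^ (m + 1) / ((m + 1).factorial : ℝ))) x := by
      intro x
      by_cases hx : 0 ≤ x
      · by_cases hxc : x ≤ c
        · rw [Set.indicator_of_mem (by exact ⟨hx, hxc⟩), if_pos hx, max_eq_left (by linarith)]
        · rw [Set.indicator_of_notMem (fun h => hxc h.2), if_pos hx, max_eq_right (by linarith)]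
          simp
      · rw [Set.indicator_of_notMem (fun h => hx h.1), if_neg hx]
    simp_rw [h1]
    rw [lintegral_indicator measurableSet_Icc, ← restrict_Ioc_eq_restrict_Icc,
      ← ofReal_integral_eq_lintegral_ofReal]
    · rw [← intervalIntegral.integral_of_le hc.le, max_eq_left hc.le]
      apply le_of_eq
      congr 1
      rw [intervalIntegral.integral_div,
        intervalIntegral.integral_comp_sub_left (fun x => x ^ (m + 1)) c]
      rw [integral_pow, Nat.factorial_succ (m + 1)]
      have := Nat.factorial_pos (m + 1)
      push_cast
      simp
      field_simp
    · apply (Continuous.integrableOn_Icc (by fun_prop)).mono_set Set.Ioc_subset_Icc_self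
    · filter_upwards [ae_restrict_mem measurableSet_Ioc] with x hx
      have : 0 ≤ c - x := by linarith [hx.2]
      positivity

/-- The simplex integrand. -/
noncomputable def simplexFun (n m : ℕ) (c : ℝ) (z : Fin n → ℝ) : ENNReal :=
  if ∀ i, 0 ≤ z i then
    ENNReal.ofReal (max (c - ∑ i, z i) 0 ^ (m + 1) / ((m + 1).factorial : ℝ)) else 0

lemma measurable_simplexFun (n m : ℕ) (c : ℝ) : Measurable (simplexFun n m c) := by
  unfold simplexFun
  refine Measurable.ite ?_ (by fun_prop) measurable_const
  have : {z : Fin n → ℝ | ∀ i, 0 ≤ z i} = ⋂ i, {z | 0 ≤ z i} := by ext; simp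
  rw [this]
  exact MeasurableSet.iInter fun i => measurableSet_le measurable_const (measurable_pi_apply i)

lemma lintegral_simplexFun (n : ℕ) : ∀ (m : ℕ) (c : ℝ),
    ∫⁻ z, simplexFun n m c z ≤
      ENNReal.ofReal (max c 0 ^ (n + m + 1) / ((n + m + 1).factorial : ℝ)) := by
  induction n with
  | zero =>
    intro m c
    rw [volume_pi, Measure.pi_of_empty, lintegral_dirac]
    simp [simplexFun]
  | succ n ih =>
    intro m c
    rw [((volume_preserving_piFinSuccAbove (fun _ : Fin (n + 1) => ℝ) 0).symm).lintegral_map_equiv]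
    rw [Measure.volume_eq_prod, lintegral_prod]
    swap
    · exact ((measurable_simplexFun _ _ _).comp (MeasurableEquiv.measurable _)).aemeasurable
    have key : ∀ (x : ℝ) (z : Fin n → ℝ),
        simplexFun (n + 1) m c ((MeasurableEquiv.piFinSuccAbove (fun _ => ℝ) 0).symm (x, z)) =
          if 0 ≤ x then simplexFun n m (c - x) z else 0 := by
      intro x z
      simp only [simplexFun, MeasurableEquiv.piFinSuccAbove_symm_apply, Fin.insertNthEquiv_apply,
        Fin.insertNth_zero', Fin.forall_fin_succ, Fin.sum_univ_succ, Fin.cons_zero, Fin.cons_succ]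
      rw [sub_sub]
      split_ifs <;> simp_all
    simp_rw [key]
    calc _ ≤ ∫⁻ x : ℝ, (if 0 ≤ x then ENNReal.ofReal
            (max (c - x) 0 ^ (n + m + 1) / ((n + m + 1).factorial : ℝ)) else 0) := by
          apply lintegral_mono
          intro x
          dsimp only
          split_ifs with hx
          · exact ih m (c - x)
          · simp
      _ ≤ _ := lintegral_one_dim (n + m) c
      _ = _ := by rw [show n + 1 + m + 1 = n + m + 2 by ring]

theorem volume_le_of_dual_lattice_polytope_barycenter_zero (n : ℕ) (hn : 1 ≤ n)
    (Q : Set (Fin n → ℝ)) (V : Finset (Fin n → ℤ))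
    (hQ : Q = convexHull ℝ ((fun v : Fin n → ℤ => fun i => (v i : ℝ)) '' ↑V))
    (h0 : (0 : Fin n → ℝ) ∈ interior Q)
    (P : Set (Fin n → ℝ))
    (hP : P = {y : Fin n → ℝ | ∀ x ∈ Q, ∑ i, y i * x i ≤ 1})
    (hbar : ∫ x in P, x = 0) :
    (volume P).toReal ≤ ((n : ℝ) + 1) ^ n / (n.factorial : ℝ) := by
  classical
  set S : Set (Fin n → ℝ) := (fun v : Fin n → ℤ => fun i => (v i : ℝ)) '' ↑V with hS
  obtain ⟨r, hr, hball⟩ := Metric.mem_nhds_iff.1 (mem_interior_iff_mem_nhds.1 h0)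
  have hclosed : IsClosed P := by
    have : P = ⋂ x ∈ Q, {y : Fin n → ℝ | ∑ i, y i * x i ≤ 1} := by
      rw [hP]; ext; simp
    rw [this]
    exact isClosed_biInter fun x _ => isClosed_le (by fun_prop) continuous_const
  have hbdd : P ⊆ Metric.closedBall 0 (2 / r) := by
    intro y hy
    rw [hP] at hy
    rw [mem_closedBall_zero_iff, pi_norm_le_iff_of_nonneg (by positivity)]
    intro i
    have hmem : ∀ t : ℝ, |t| < r → (Pi.single i t : Fin n → ℝ) ∈ Q := by
      intro t ht
      apply hball
      rw [mem_ball_zero_iff, Pi.norm_single]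
      exact ht
    have h1 := hy _ (hmem (r / 2) (by rw [abs_of_pos (by positivity)]; linarith))
    have h2 := hy _ (hmem (-(r / 2)) (by rw [abs_neg, abs_of_pos (by positivity)]; linarith))
    simp [Pi.single_apply] at h1 h2
    rw [Real.norm_eq_abs, abs_le]
    constructor
    · rw [← neg_div, div_le_iff₀ hr]; linarith
    · rw [le_div_iff₀ hr]; linarith
  have hcomp : IsCompact P := (isCompact_closedBall _ _).of_isClosed_subset hclosed hbdd
  have hspan : Submodule.span ℝ S = ⊤ := by
    apply Submodule.eq_top_of_nonempty_interior'
    refine ⟨0, interior_mono ?_ h0⟩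
    rw [hQ]
    exact convexHull_min Submodule.subset_span (Submodule.convex _)
  have hd : Module.finrank ℝ (Submodule.span ℝ S) = n := by
    rw [hspan, finrank_top, Module.finrank_fin_fun]
  obtain ⟨f, hfS, hfli⟩ : ∃ f : Fin n → (Fin n → ℝ), (∀ i, f i ∈ S) ∧ LinearIndependent ℝ f := by
    obtain ⟨f, hfS, -, hfli⟩ := Submodule.exists_fun_fin_finrank_span_eq ℝ S
    exact ⟨f ∘ finCongr hd.symm, fun i => hfS _, hfli.comp _ (finCongr hd.symm).injective⟩
  have hfQ : ∀ i, f i ∈ Q := fun i => hQ ▸ subset_convexHull ℝ S (hfS i)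
  choose A hAV hA using hfS
  set M : Matrix (Fin n) (Fin n) ℝ := Matrix.of f with hM
  have hMA : M = (Matrix.of A).map (Int.castRingHom ℝ) := by
    ext i j
    simp [hM, ← hA]
  have hMu : IsUnit M := Matrix.linearIndependent_rows_iff_isUnit.1 hfli
  have hdet : M.det ≠ 0 := ((Matrix.isUnit_iff_isUnit_det M).1 hMu).ne_zero
  have hdet1 : 1 ≤ |M.det| := by
    have h : M.det = ((Matrix.of A).det : ℝ) := by
      rw [hMA]
      exact ((Int.castRingHom ℝ).map_det _).symm
    rw [h] at hdet ⊢
    have hdetZ : (Matrix.of A).det ≠ 0 := by exact_mod_cast hdet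
    exact_mod_cast Int.one_le_abs hdetZ
  set L : (Fin n → ℝ) →L[ℝ] ℝ :=
    LinearMap.toContinuousLinearMap (∑ i, (LinearMap.proj i).comp (Matrix.toLin' M)) with hL
  have hLa : ∀ y, L y = ∑ i, (M.mulVec y) i := by
    intro y
    simp [hL]
  have hPfin : volume P ≠ ⊤ := hcomp.measure_lt_top.ne
  have hLint : IntegrableOn (fun y => L y) P := L.continuous.continuousOn.integrableOn_compact hcomp
  have hone : IntegrableOn (fun _ : Fin n → ℝ => (1 : ℝ)) P := integrableOn_const hPfin
  have hid : IntegrableOn (fun y : Fin n → ℝ => y) P :=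
    continuous_id.continuousOn.integrableOn_compact hcomp
  have hint : ∫ y in P, (1 + L y) = (volume P).toReal := by
    rw [integral_add hone hLint, L.integral_comp_comm hid, hbar]
    simp [Measure.real]
  have hbound : ENNReal.ofReal (∫ y in P, (1 + L y)) ≤
      ENNReal.ofReal (((n : ℝ) + 1) ^ n / (n.factorial : ℝ)) := by
    calc ENNReal.ofReal (∫ y in P, (1 + L y))
        ≤ ∫⁻ y in P, ENNReal.ofReal (1 + L y) := by
          have hi : Integrable (fun y => 1 + L y) (volume.restrict P) := hone.add hLint
          have h1 : ∫ y in P, (1 + L y) ≤ ∫ y in P, max (1 + L y) 0 :=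
            integral_mono hi hi.pos_part fun y => le_max_left _ _
          refine (ENNReal.ofReal_le_ofReal h1).trans (le_of_eq ?_)
          rw [ofReal_integral_eq_lintegral_ofReal hi.pos_part
            (Filter.Eventually.of_forall fun y => le_max_right _ _)]
          simp
      _ ≤ ∫⁻ y in P, simplexFun n 0 (n + 1) (1 - Matrix.toLin' M y) := by
          refine setLIntegral_mono' hclosed.measurableSet ?_
          intro y hy
          have hpos : ∀ i, 0 ≤ (1 - Matrix.toLin' M y) i := by
            intro i
            rw [hP] at hy
            have := hy _ (hfQ i)
            simp only [Pi.sub_apply, Pi.one_apply, Matrix.toLin'_apply, Matrix.mulVec, dotProduct,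
              hM, Matrix.of_apply, sub_nonneg]
            simpa [mul_comm] using this
          rw [simplexFun, if_pos hpos]
          apply ENNReal.ofReal_le_ofReal
          simp [hLa]
      _ ≤ ∫⁻ y, simplexFun n 0 (n + 1) (1 - Matrix.toLin' M y) := setLIntegral_le_lintegral _ _
      _ = ∫⁻ z, simplexFun n 0 (n + 1) (1 - z) ∂(Measure.map (Matrix.toLin' M) volume) := by
          rw [lintegral_map]
          · exact (measurable_simplexFun _ _ _).comp (measurable_const.sub measurable_id)
          · exact (LinearMap.continuous_of_finiteDimensional _).measurable
      _ = ENNReal.ofReal |M.det⁻¹| * ∫⁻ z, simplexFun n 0 (n + 1) z := by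
          rw [Real.map_matrix_volume_pi_eq_smul_volume_pi hdet, lintegral_smul_measure,
            lintegral_sub_left_eq_self (simplexFun n 0 (n + 1))]
          rfl
      _ ≤ 1 * ENNReal.ofReal (max ((n : ℝ) + 1) 0 ^ (n + 0 + 1) / ((n + 0 + 1).factorial : ℝ)) := by
          gcongr
          · rw [ENNReal.ofReal_le_one, abs_inv]
            exact inv_le_one_of_one_le₀ hdet1
          · exact lintegral_simplexFun n 0 _
      _ = _ := by
          rw [one_mul, max_eq_left (by positivity), add_zero, Nat.factorial_succ]
          congr 1
          have := Nat.factorial_pos n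
          push_cast
          field_simp
          ring
  rw [hint] at hbound
  exact (ENNReal.ofReal_le_ofReal_iff (by positivity)).1 hbound
end

section
/- (Grünbaum's inequality.) Let K be a convex body in ℝⁿ with barycenter b, and let H be a closed affine half-space whose boundary hyperplane passes through b, i.e. H = {x ∈ ℝⁿ : ⟨x − b, θ⟩ ≥ 0} for some unit vector θ. Then Vol(K ∩ H) ≥ (n/(n+1))ⁿ · Vol(K). -/
open MeasureTheory
open scoped ENNReal Pointwise

lemma bm1_compact (A B C : Set ℝ) (hA : IsCompact A) (hB : IsCompact B)
    (hA0 : A.Nonempty) (hB0 : B.Nonempty) (hC : ∀ x ∈ A, ∀ y ∈ B, x + y ∈ C) :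
    volume A + volume B ≤ volume C := by
  obtain ⟨p, hpA, hp⟩ := hA.exists_isGreatest hA0
  obtain ⟨q, hqB, hq⟩ := hB.exists_isLeast hB0
  have h1 : volume ((fun x => x + q) '' A) = volume A := by
    simp
  have h2 : volume ((fun x => p + x) '' B) = volume B := by
    simp
  have hm : MeasurableSet ((fun x => p + x) '' B) :=
    (hB.image (by fun_prop)).measurableSet
  have hd : AEDisjoint volume ((fun x => x + q) '' A) ((fun x => p + x) '' B) := by
    refine measure_mono_null (t := {p + q}) ?_ (by simp)
    rintro _ ⟨⟨x, hx, rfl⟩, ⟨y, hy, hxy⟩⟩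
    have := hp hx
    have := hq hy
    simp only [Set.mem_singleton_iff] at *
    linarith
  rw [← h1, ← h2, ← measure_union₀ hm.nullMeasurableSet hd]
  apply measure_mono
  rintro _ (⟨x, hx, rfl⟩ | ⟨x, hx, rfl⟩)
  · exact hC _ hx _ hqB
  · exact hC _ hpA _ hx

lemma bm1_meas (A B C : Set ℝ) (hA : MeasurableSet A) (hB : MeasurableSet B)
    (hA0 : A.Nonempty) (hB0 : B.Nonempty) (hC : ∀ x ∈ A, ∀ y ∈ B, x + y ∈ C) :
    volume A + volume B ≤ volume C := by
  obtain ⟨x0, hx0⟩ := hA0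
  obtain ⟨y0, hy0⟩ := hB0
  have key : ∀ K L : Set ℝ, K ⊆ A → IsCompact K → L ⊆ B → IsCompact L →
      volume K + volume L ≤ volume C := by
    intro K L hK hK' hL hL'
    calc volume K + volume L ≤ volume (insert x0 K) + volume (insert y0 L) := by
          gcongr <;> exact Set.subset_insert _ _
      _ ≤ volume C := by
          apply bm1_compact _ _ _ (hK'.insert _) (hL'.insert _) ⟨_, Set.mem_insert _ _⟩
            ⟨_, Set.mem_insert _ _⟩
          intro x hx y hy
          exact hC _ (Set.insert_subset hx0 hK hx) _ (Set.insert_subset hy0 hL hy)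
  rw [hA.measure_eq_iSup_isCompact, hB.measure_eq_iSup_isCompact]
  simp only [iSup_and']
  apply ENNReal.biSup_add_biSup_le' ⟨∅, by simp⟩ ⟨∅, by simp⟩
  rintro K ⟨h1, h2⟩ L ⟨h3, h4⟩
  exact key K L h1 h2 h3 h4

lemma bm1 (A B C : Set ℝ) (a b : ℝ) (ha : 0 < a) (hb : 0 < b)
    (hA : MeasurableSet A) (hB : MeasurableSet B)
    (hA0 : A.Nonempty) (hB0 : B.Nonempty) (hC : ∀ x ∈ A, ∀ y ∈ B, a * x + b * y ∈ C) :
    ENNReal.ofReal a * volume A + ENNReal.ofReal b * volume B ≤ volume C := by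
  have := bm1_meas (a • A) (b • B) C (hA.const_smul₀ a) (hB.const_smul₀ b) hA0.smul_set hB0.smul_set ?_
  · simpa [Measure.addHaar_smul, abs_of_pos, ha, hb] using this
  · rintro _ ⟨x, hx, rfl⟩ _ ⟨y, hy, rfl⟩
    exact hC x hx y hy

lemma pl1_norm (f g h : ℝ → ℝ≥0∞) (a b : ℝ) (ha : 0 < a) (hb : 0 < b) (hab : a + b = 1)
    (hf : Measurable f) (hg : Measurable g) (hh : Measurable h)
    (hf1 : ∀ x, f x ≤ 1) (hg1 : ∀ x, g x ≤ 1)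
    (hf2 : ∀ t < 1, ∃ x, t < f x) (hg2 : ∀ t < 1, ∃ x, t < g x)
    (H : ∀ x y, f x ^ a * g y ^ b ≤ h (a * x + b * y)) :
    ENNReal.ofReal a * (∫⁻ x, f x) + ENNReal.ofReal b * (∫⁻ x, g x) ≤ ∫⁻ x, h x := by
  have lay : ∀ u : ℝ → ℝ≥0∞, Measurable u → (∀ x, u x ≤ 1) →
      ∫⁻ x, u x = ∫⁻ t in Set.Ioi (0:ℝ), volume {x | ENNReal.ofReal t < u x} := by
    intro u hu hu1
    have h1 : ∀ x, u x ≠ ⊤ := fun x => ne_top_of_le_ne_top ENNReal.one_ne_top (hu1 x)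
    have := lintegral_eq_lintegral_meas_lt volume (f := fun x => (u x).toReal)
      (Filter.Eventually.of_forall fun x => ENNReal.toReal_nonneg) hu.ennreal_toReal.aemeasurable
    simp only [ENNReal.ofReal_toReal (h1 _)] at this
    rw [this]
    refine setLIntegral_congr_fun measurableSet_Ioi fun t ht => ?_
    simp only [ENNReal.ofReal_lt_iff_lt_toReal (le_of_lt ht) (h1 _)]
  have meas : ∀ u : ℝ → ℝ≥0∞, Measurable fun t : ℝ => volume {x | ENNReal.ofReal t < u x} := by
    intro u
    apply Antitone.measurable
    intro s t hst
    apply measure_mono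
    intro x hx
    exact lt_of_le_of_lt (ENNReal.ofReal_le_ofReal hst) hx
  calc _ ≤ ∫⁻ x, min (h x) 1 := ?_
    _ ≤ _ := lintegral_mono fun x => min_le_left _ _
  rw [lay f hf hf1, lay g hg hg1, lay _ (hh.min measurable_const) (fun x => min_le_right _ _),
    ← lintegral_const_mul _ (meas f), ← lintegral_const_mul _ (meas g),
    ← lintegral_add_left ((meas f).const_mul _)]
  refine setLIntegral_mono (meas _) fun t ht => ?_
  rcases lt_or_ge (ENNReal.ofReal t) 1 with h1 | h1
  · apply bm1 _ _ _ a b ha hb (measurableSet_lt measurable_const hf)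
      (measurableSet_lt measurable_const hg) (hf2 _ h1) (hg2 _ h1)
    intro x hx y hy
    simp only [Set.mem_ofPred_eq, lt_min_iff] at *
    refine ⟨lt_of_lt_of_le ?_ (H x y), h1⟩
    have e : ENNReal.ofReal t = ENNReal.ofReal t ^ a * ENNReal.ofReal t ^ b := by
      rw [← ENNReal.rpow_add_of_nonneg _ _ ha.le hb.le, hab, ENNReal.rpow_one]
    rw [e]
    exact ENNReal.mul_lt_mul (ENNReal.rpow_lt_rpow hx ha) (ENNReal.rpow_lt_rpow hy hb)
  · have e1 : {x | ENNReal.ofReal t < f x} = ∅ := by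
      ext x; simpa using (hf1 x).trans h1
    have e2 : {x | ENNReal.ofReal t < g x} = ∅ := by
      ext x; simpa using (hg1 x).trans h1
    simp [e1, e2]

lemma amgm (X Y : ℝ≥0∞) (a b : ℝ) (ha : 0 < a) (hb : 0 < b) (hab : a + b = 1) :
    X ^ a * Y ^ b ≤ ENNReal.ofReal a * X + ENNReal.ofReal b * Y := by
  have hpq : (a⁻¹).HolderConjugate b⁻¹ := by
    rw [Real.holderConjugate_iff]
    refine ⟨(one_lt_inv₀ ha).2 (by linarith), by simpa using hab⟩
  have := ENNReal.young_inequality (X ^ a) (Y ^ b) hpq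
  rw [← ENNReal.rpow_mul, ← ENNReal.rpow_mul, mul_inv_cancel₀ ha.ne', mul_inv_cancel₀ hb.ne',
    ENNReal.rpow_one, ENNReal.rpow_one, ENNReal.ofReal_inv_of_pos ha,
    ENNReal.ofReal_inv_of_pos hb, div_eq_mul_inv, div_eq_mul_inv, inv_inv, inv_inv,
    mul_comm X, mul_comm Y] at this
  exact this

lemma pl1_bdd (f g h : ℝ → ℝ≥0∞) (a b : ℝ) (ha : 0 < a) (hb : 0 < b) (hab : a + b = 1)
    (hf : Measurable f) (hg : Measurable g) (hh : Measurable h)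
    (hf1 : ⨆ x, f x ≠ ⊤) (hg1 : ⨆ x, g x ≠ ⊤)
    (H : ∀ x y, f x ^ a * g y ^ b ≤ h (a * x + b * y)) :
    (∫⁻ x, f x) ^ a * (∫⁻ x, g x) ^ b ≤ ∫⁻ x, h x := by
  set α := ⨆ x, f x with hα
  set β := ⨆ x, g x with hβ
  by_cases hα0 : α = 0
  · have : ∀ x, f x = 0 := by simpa [hα] using hα0
    simp [this, ha]
  by_cases hβ0 : β = 0
  · have : ∀ x, g x = 0 := by simpa [hβ] using hβ0
    simp [this, hb]
  have hαa : α ^ a ≠ 0 := by simp [hα0, hf1]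
  have hβb : β ^ b ≠ 0 := by simp [hβ0, hg1]
  have hαa' : α ^ a ≠ ⊤ := by simp [hα0, hf1]
  have hβb' : β ^ b ≠ ⊤ := by simp [hβ0, hg1]
  have e : ∀ X Y : ℝ≥0∞, (X / α) ^ a * (Y / β) ^ b = X ^ a * Y ^ b / (α ^ a * β ^ b) := by
    intro X Y
    rw [ENNReal.div_rpow_of_nonneg _ _ ha.le, ENNReal.div_rpow_of_nonneg _ _ hb.le,
      div_eq_mul_inv, div_eq_mul_inv, div_eq_mul_inv,
      ENNReal.mul_inv (Or.inl hαa) (Or.inl hαa')]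
    ring
  have nrm : ∀ u : ℝ → ℝ≥0∞, (⨆ x, u x) ≠ 0 → (⨆ x, u x) ≠ ⊤ → 
      ∀ t < 1, ∃ x, t < u x / ⨆ x, u x := by
    intro u h0 h1 t ht
    have : t * (⨆ x, u x) < ⨆ x, u x := by
      conv_rhs => rw [← one_mul (⨆ x, u x)]
      exact ENNReal.mul_lt_mul_left h0 h1 ht
    obtain ⟨x, hx⟩ := lt_iSup_iff.1 this
    exact ⟨x, (ENNReal.lt_div_iff_mul_lt (Or.inl h0) (Or.inl h1)).2 hx⟩
  have key := pl1_norm (fun x => f x / α) (fun x => g x / β) (fun x => h x / (α ^ a * β ^ b))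
    a b ha hb hab (hf.div_const _) (hg.div_const _) (hh.div_const _)
    (fun x => ENNReal.div_le_of_le_mul (by simpa using le_iSup f x))
    (fun x => ENNReal.div_le_of_le_mul (by simpa using le_iSup g x))
    (nrm f hα0 hf1) (nrm g hβ0 hg1)
    (fun x y => by
      simp only [e]
      exact ENNReal.div_le_div_right (H x y) _)
  have := (amgm _ _ a b ha hb hab).trans key
  simp only [div_eq_mul_inv] at this
  rw [lintegral_mul_const _ hf, lintegral_mul_const _ hg, lintegral_mul_const _ hh] at this
  simp only [← div_eq_mul_inv] at this
  rw [e] at this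
  rwa [ENNReal.div_le_iff (mul_ne_zero hαa hβb) (ENNReal.mul_ne_top hαa' hβb'),
    ENNReal.div_mul_cancel (mul_ne_zero hαa hβb) (ENNReal.mul_ne_top hαa' hβb')] at this

lemma pl1 (f g h : ℝ → ℝ≥0∞) (a b : ℝ) (ha : 0 < a) (hb : 0 < b) (hab : a + b = 1)
    (hf : Measurable f) (hg : Measurable g) (hh : Measurable h)
    (H : ∀ x y, f x ^ a * g y ^ b ≤ h (a * x + b * y)) :
    (∫⁻ x, f x) ^ a * (∫⁻ x, g x) ^ b ≤ ∫⁻ x, h x := by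
  by_cases hf0 : ∫⁻ x, f x = 0
  · simp [hf0, ha]
  by_cases hg0 : ∫⁻ x, g x = 0
  · simp [hg0, hb]
  have lim : ∀ u : ℝ → ℝ≥0∞, Measurable u → 
      Filter.Tendsto (fun N : ℕ => ∫⁻ x, min (u x) N) Filter.atTop (nhds (∫⁻ x, u x)) := by
    intro u hu
    apply lintegral_tendsto_of_tendsto_of_monotone
    · exact fun N => (hu.min measurable_const).aemeasurable
    · refine Filter.Eventually.of_forall fun x M N hMN => ?_
      dsimp only
      gcongr
    · refine Filter.Eventually.of_forall fun x => ?_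
      have : Filter.Tendsto (fun N : ℕ => min (u x) (N : ℝ≥0∞)) Filter.atTop
          (nhds (min (u x) ⊤)) := tendsto_const_nhds.min ENNReal.tendsto_nat_nhds_top
      simpa using this
  have l2 := ENNReal.Tendsto.mul (((ENNReal.continuous_rpow_const (y := a)).tendsto _).comp (lim f hf))
    (Or.inl (by simp [hf0, ha, ha.not_gt])) (((ENNReal.continuous_rpow_const (y := b)).tendsto _).comp (lim g hg)) 
    (Or.inl (by simp [hg0, hb, hb.not_gt]))
  refine le_of_tendsto' l2 fun N => ?_
  have bd : ∀ u : ℝ → ℝ≥0∞, (⨆ x, min (u x) (N : ℝ≥0∞)) ≠ ⊤ := fun u =>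
    ne_top_of_le_ne_top (ENNReal.natCast_ne_top N) (iSup_le fun x => min_le_right _ _)
  apply pl1_bdd _ _ h a b ha hb hab (hf.min measurable_const) (hg.min measurable_const) hh
    (bd f) (bd g)
  intro x y
  refine le_trans ?_ (H x y)
  gcongr <;> exact min_le_left _ _

lemma pl (n : ℕ) (f g h : (Fin n → ℝ) → ℝ≥0∞) (a b : ℝ) (ha : 0 < a) (hb : 0 < b)
    (hab : a + b = 1)
    (hf : Measurable f) (hg : Measurable g) (hh : Measurable h)
    (H : ∀ x y, f x ^ a * g y ^ b ≤ h (a • x + b • y)) :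
    (∫⁻ x, f x) ^ a * (∫⁻ x, g x) ^ b ≤ ∫⁻ x, h x := by
  induction n with
  | zero =>
    have : (volume : Measure (Fin 0 → ℝ)) Set.univ = 1 := by
      rw [volume_pi, Measure.pi_of_empty]; simp
    rw [lintegral_unique, lintegral_unique, lintegral_unique, this]
    rw [mul_one, mul_one, mul_one]
    exact (H _ _).trans_eq (congrArg h (Subsingleton.elim _ _))
  | succ n ih =>
    have mp := (volume_preserving_piFinSuccAbove (fun _ : Fin (n+1) => ℝ) 0).symm
    set e := (MeasurableEquiv.piFinSuccAbove (fun _ : Fin (n+1) => ℝ) 0).symm with he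
    have fub : ∀ u : (Fin (n+1) → ℝ) → ℝ≥0∞, Measurable u →
        ∫⁻ x, u x = ∫⁻ t : ℝ, ∫⁻ y : Fin n → ℝ, u (e (t, y)) := by
      intro u hu
      rw [← mp.lintegral_comp hu, Measure.volume_eq_prod, lintegral_prod]
      exact (hu.comp e.measurable).aemeasurable
    have ms : ∀ u : (Fin (n+1) → ℝ) → ℝ≥0∞, Measurable u → Measurable fun p => u (e p) :=
      fun u hu => hu.comp e.measurable
    rw [fub f hf, fub g hg, fub h hh]
    apply pl1 _ _ _ a b ha hb hab (ms f hf).lintegral_prod_right' (ms g hg).lintegral_prod_right'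
      (ms h hh).lintegral_prod_right'
    intro s t
    apply ih
    · exact (ms f hf).comp measurable_prodMk_left
    · exact (ms g hg).comp measurable_prodMk_left
    · exact (ms h hh).comp measurable_prodMk_left
    intro x y
    refine (H _ _).trans_eq (congrArg h ?_)
    ext i
    refine Fin.cases ?_ (fun j => ?_) i <;> simp [he, MeasurableEquiv.piFinSuccAbove]

/-- Brunn-Minkowski. -/
lemma bm (n : ℕ) (A B C : Set (Fin n → ℝ)) (hA : MeasurableSet A) (hB : MeasurableSet B)
    (hC : MeasurableSet C) (m : ℝ) (m' : ℝ) (hm : 0 < m) (hm' : 0 < m')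
    (p q : ℝ) (hp : 0 < p) (hq : 0 < q)
    (hpA : volume A = ENNReal.ofReal (p ^ n)) (hqB : volume B = ENNReal.ofReal (q ^ n))
    (H : ∀ x ∈ A, ∀ y ∈ B, m • x + m' • y ∈ C) :
    ENNReal.ofReal ((m * p + m' * q) ^ n) ≤ volume C := by
  set D := m * p + m' * q with hD
  have hDp : 0 < D := by positivity
  have ind : ∀ (S : Set (Fin n → ℝ)) (r : ℝ), MeasurableSet S → 0 < r →
      ∫⁻ x, S.indicator (fun _ => (1 : ℝ≥0∞)) (r • x) = ENNReal.ofReal ((r ^ n)⁻¹) * volume S := by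
    intro S r hS hr
    have := Measure.addHaar_preimage_smul (volume : Measure (Fin n → ℝ)) hr.ne' S
    rw [abs_of_pos (by positivity), Module.finrank_fin_fun] at this
    rw [← this, ← lintegral_indicator_one (hS.preimage (measurable_const_smul r))]
    rfl
  have mind : ∀ (S : Set (Fin n → ℝ)) (r : ℝ), MeasurableSet S → 
      Measurable fun x => S.indicator (fun _ => (1 : ℝ≥0∞)) (r • x) := fun S r hS =>
    (measurable_const.indicator hS).comp (measurable_const_smul r)
  have key := pl n (fun x => A.indicator (fun _ => (1 : ℝ≥0∞)) (p • x))
    (fun x => B.indicator (fun _ => (1 : ℝ≥0∞)) (q • x))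
    (fun x => C.indicator (fun _ => (1 : ℝ≥0∞)) (D • x))
    (m * p / D) (m' * q / D) (by positivity) (by positivity) (by rw [← add_div, ← hD, div_self hDp.ne'])
    (mind _ _ hA) (mind _ _ hB) (mind _ _ hC) ?_
  · rw [ind _ _ hA hp, ind _ _ hB hq, ind _ _ hC hDp, hpA, hqB,
      ← ENNReal.ofReal_mul (by positivity), ← ENNReal.ofReal_mul (by positivity),
      inv_mul_cancel₀ (by positivity), inv_mul_cancel₀ (by positivity)] at key
    simp only [ENNReal.ofReal_one, ENNReal.one_rpow, mul_one] at key
    calc ENNReal.ofReal (D ^ n) ≤ ENNReal.ofReal (D ^ n) * (ENNReal.ofReal ((D ^ n)⁻¹) * volume C) :=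
          le_mul_of_one_le_right' key
      _ = volume C := by
          rw [← mul_assoc, ← ENNReal.ofReal_mul (by positivity), mul_inv_cancel₀ (by positivity)]
          simp
  · intro x y
    have h1 : 0 < m * p / D := by positivity
    have h2 : 0 < m' * q / D := by positivity
    by_cases hx : p • x ∈ A
    · by_cases hy : q • y ∈ B
      · have : D • ((m * p / D) • x + (m' * q / D) • y) ∈ C := by
          have := H _ hx _ hy
          convert this using 1
          rw [smul_add, smul_smul, smul_smul, smul_smul, smul_smul, mul_div_cancel₀ _ hDp.ne',
            mul_div_cancel₀ _ hDp.ne']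
        simp only [Set.indicator_of_mem hx, Set.indicator_of_mem hy, Set.indicator_of_mem this,
          ENNReal.one_rpow, mul_one, le_refl]
      · simp [hy, h2]
    · simp [hx, h1]

lemma final1d (n : ℕ) (hn : n ≠ 0) (f : ℝ → ℝ) (v M0 : ℝ) (hv : 0 < v) (hf0 : ∀ t, 0 ≤ f t)
    (hfv : ∀ t, f t ≤ v) (hfv' : ∃ t < 0, f t = v) (hanti : Antitone f)
    (hconc : ∀ s t m m', 0 < f s → 0 < f t → 0 < m → 0 < m' → m + m' = 1 →
      m * f s + m' * f t ≤ f (m * s + m' * t))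
    (hpos : ∃ t > 0, 0 < f t)
    (hint : ∀ M ≥ M0, M * v ^ n = ∫ t in Set.Ioi (0:ℝ), f (t - M) ^ n) :
    (n : ℝ) / (n + 1) * v ≤ f 0 := by
  obtain ⟨t0, ht0, hft0⟩ := hpos
  have hf00 : 0 < f 0 := hft0.trans_le (hanti ht0.le)
  -- supergradient
  obtain ⟨s, hs0, hs⟩ : ∃ s, 0 ≤ s ∧ ∀ t, 0 < f t → f t ≤ f 0 - s * t := by
    let S : Set ℝ := {z | ∃ t > 0, 0 < f t ∧ z = (f 0 - f t) / t}
    have hSne : S.Nonempty := ⟨_, t0, ht0, hft0, rfl⟩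
    have hS0 : ∀ z ∈ S, 0 ≤ z := by
      rintro _ ⟨t, ht, -, rfl⟩
      exact div_nonneg (sub_nonneg.2 (hanti ht.le)) ht.le
    refine ⟨sInf S, le_csInf hSne hS0, fun t ht => ?_⟩
    rcases lt_trichotomy t 0 with h | h | h
    · have : (f t - f 0) / (-t) ≤ sInf S := by
        apply le_csInf hSne
        rintro _ ⟨u, hu, hfu, rfl⟩
        rw [div_le_div_iff₀ (by linarith) hu]
        have hut : 0 < u - t := by linarith
        have := hconc t u (u / (u - t)) (-t / (u - t)) ht hfu (div_pos hu hut)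
          (div_pos (by linarith) hut) (by rw [← add_div, ← sub_eq_add_neg, div_self hut.ne'])
        have e : u / (u - t) * t + -t / (u - t) * u = 0 := by ring
        rw [e] at this
        have e2 : u / (u - t) * f t + -t / (u - t) * f u = (u * f t - t * f u) / (u - t) := by ring
        rw [e2, div_le_iff₀ hut] at this
        linarith
      rw [div_le_iff₀ (by linarith)] at this
      linarith
    · simp [h]
    · have : sInf S ≤ (f 0 - f t) / t := csInf_le ⟨0, hS0⟩ ⟨t, h, ht, rfl⟩
      rw [le_div_iff₀ h] at this
      linarith
  have hn1 : (0:ℝ) < n + 1 := by positivity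
  rcases hs0.eq_or_lt with rfl | hs0
  · obtain ⟨t, -, ht⟩ := hfv'
    have := hs t (by rw [ht]; exact hv)
    rw [div_mul_eq_mul_div, div_le_iff₀ hn1]
    nlinarith
  set r := f 0 / s with hr
  set M := max M0 (v / s) with hM
  have hvs : 0 < v / s := by positivity
  have hrp : 0 < r := by positivity
  have hMv : v / s ≤ M := le_max_right _ _
  set R := r + M with hR
  set T := R - v / s with hT
  have hT0 : 0 ≤ T := by linarith
  have hTR : T ≤ R := by linarith
  have I := hint M (le_max_left _ _)
  have hφanti : Antitone fun t => f (t - M) ^ n := fun x y hxy =>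
    pow_le_pow_left₀ (hf0 _) (hanti (by linarith)) _
  have hii : ∀ a b, IntervalIntegrable (fun t => f (t - M) ^ n) volume a b := fun a b =>
    hφanti.intervalIntegrable
  have I2 : ∫ t in Set.Ioi (0:ℝ), f (t - M) ^ n = ∫ t in (0:ℝ)..R, f (t - M) ^ n := by
    rw [intervalIntegral.integral_of_le (hT0.trans hTR)]
    apply setIntegral_eq_of_subset_of_forall_sdiff_eq_zero measurableSet_Ioi
    · exact fun x hx => hx.1
    · rintro x ⟨hx, hx'⟩
      have hxR : R < x := by
        by_contra h
        exact hx' ⟨hx, not_lt.1 h⟩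
      have : f (x - M) = 0 := by
        by_contra h
        have hp := lt_of_le_of_ne (hf0 _) (Ne.symm h)
        have h1 := hs _ hp
        have h2 : s * r < s * (x - M) := mul_lt_mul_of_pos_left (by linarith) hs0
        have h3 : s * r = f 0 := by rw [hr]; field_simp
        linarith
      rw [this, zero_pow hn]
  rw [I2, ← intervalIntegral.integral_add_adjacent_intervals (hii 0 T) (hii T R)] at I
  have I3 : ∫ t in (0:ℝ)..T, f (t - M) ^ n ≤ T * v ^ n := by
    calc _ ≤ ∫ t in (0:ℝ)..T, v ^ n :=
          intervalIntegral.integral_mono_on hT0 (hii _ _) (by simp) 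
            fun x _ => pow_le_pow_left₀ (hf0 _) (hfv _) _
      _ = _ := by simp
  have I4 : ∫ t in T..R, f (t - M) ^ n ≤ v / s * v ^ n / (n + 1) := by
    calc _ ≤ ∫ t in T..R, (s * (R - t)) ^ n := by
          apply intervalIntegral.integral_mono_on hTR (hii _ _)
            (Continuous.intervalIntegrable (by fun_prop) _ _)
          intro x hx
          apply pow_le_pow_left₀ (hf0 _)
          rcases (hf0 (x - M)).eq_or_lt with h | h
          · rw [← h]
            exact mul_nonneg hs0.le (by linarith [hx.2])
          · have h1 := hs _ h
            have h3 : s * r = f 0 := by rw [hr]; field_simp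
            rw [hR]
            linarith
      _ = s ^ n * ∫ t in T..R, (R - t) ^ n := by
          simp only [mul_pow, intervalIntegral.integral_const_mul]
      _ = s ^ n * ((v / s) ^ (n + 1) / (n + 1)) := by
          rw [intervalIntegral.integral_comp_sub_left (fun t => t ^ n)]
          simp [hT]
      _ = _ := by
          rw [div_pow]
          field_simp
          ring
  have I5 : M * v ^ n ≤ (T + v / s / (n + 1)) * v ^ n := by
    have : v / s * v ^ n / (n + 1) = v / s / (n + 1) * v ^ n := by ring
    rw [this] at I4
    linarith
  have I6 := le_of_mul_le_mul_right I5 (by positivity)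
  have I7 : v / s - v / s / (n + 1) ≤ r := by linarith
  have : (n : ℝ) / (n + 1) * v = s * (v / s - v / s / (n + 1)) := by
    field_simp
    ring
  rw [this]
  calc _ ≤ s * r := by gcongr
    _ = f 0 := by rw [hr]; field_simp

/-- Grünbaum's inequality: If `K ⊆ ℝⁿ` is a convex body with barycenter
`b` and `H = {x : ⟨x - b, θ⟩ ≥ 0}` is a closed half-space whose boundary hyperplane
passes through `b` (with `θ` a unit vector), then
`Vol(K ∩ H) ≥ (n/(n+1))ⁿ · Vol(K)`. -/
theorem grunbaum_inequality (n : ℕ) (K : Set (Fin n → ℝ))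
    (hconv : Convex ℝ K) (hcomp : IsCompact K) (hint : (interior K).Nonempty)
    (b θ : Fin n → ℝ) (hθ : ∑ i, θ i ^ 2 = 1)
    (hbar : ∫ x in K, x = (volume K).toReal • b)
    (H : Set (Fin n → ℝ))
    (hH : H = {x : Fin n → ℝ | 0 ≤ ∑ i, (x i - b i) * θ i}) :
    ((n : ℝ) / ((n : ℝ) + 1)) ^ n * (volume K).toReal ≤ (volume (K ∩ H)).toReal := by
  
  have hn : n ≠ 0 := by
    rintro rfl
    simp at hθ
  let L : (Fin n → ℝ) →L[ℝ] ℝ := ∑ i, θ i • ContinuousLinearMap.proj i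
  have hL : ∀ x, L x = ∑ i, θ i * x i := fun x => by simp [L]
  let h : (Fin n → ℝ) → ℝ := fun x => L x - L b
  have hh : ∀ x, h x = ∑ i, (x i - b i) * θ i := by
    intro x
    simp only [h, hL, ← Finset.sum_sub_distrib]
    exact Finset.sum_congr rfl fun i _ => by ring
  have hcont : Continuous h := L.continuous.sub continuous_const
  have hKm : MeasurableSet K := hcomp.measurableSet
  have hKfin : volume K ≠ ⊤ := hcomp.measure_lt_top.ne
  let Kt : ℝ → Set (Fin n → ℝ) := fun t => K ∩ {x | t ≤ h x}
  have hKtm : ∀ t, MeasurableSet (Kt t) := fun t =>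
    hKm.inter (measurableSet_le measurable_const hcont.measurable)
  have hKtK : ∀ t, volume (Kt t) ≤ volume K := fun t => measure_mono Set.inter_subset_left
  have hKtfin : ∀ t, volume (Kt t) ≠ ⊤ := fun t => ne_top_of_le_ne_top hKfin (hKtK t)
  have hHK : K ∩ H = Kt 0 := by
    simp only [Kt, hH, hh]
  let f : ℝ → ℝ := fun t => (volume (Kt t)).toReal ^ ((n : ℝ)⁻¹)
  let v : ℝ := (volume K).toReal ^ ((n : ℝ)⁻¹)
  have hfn : ∀ t, f t ^ n = (volume (Kt t)).toReal := fun t =>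
    Real.rpow_inv_natCast_pow ENNReal.toReal_nonneg hn
  have hvn : v ^ n = (volume K).toReal := Real.rpow_inv_natCast_pow ENNReal.toReal_nonneg hn
  have hKpos : 0 < volume K :=
    (isOpen_interior.measure_pos volume hint).trans_le (measure_mono interior_subset)
  have hKpos' : 0 < (volume K).toReal := ENNReal.toReal_pos hKpos.ne' hKfin
  have hLi : IntegrableOn (fun x => L x) K := L.continuous.continuousOn.integrableOn_compact hcomp
  have hhi : IntegrableOn h K := hcont.continuousOn.integrableOn_compact hcomp
  have hinth : ∫ x in K, h x = 0 := by
    have h1 : ∫ x in K, L x = L (∫ x in K, x) :=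
      L.integral_comp_comm (continuous_id.continuousOn.integrableOn_compact hcomp)
    simp only [h]
    rw [integral_sub hLi (integrable_const_iff.2 (Or.inr (by
      simpa [isFiniteMeasure_restrict] using hKfin))), h1, hbar]
    simp [Measure.real]
  obtain ⟨M0, hM0⟩ : ∃ M0 : ℝ, ∀ x ∈ K, -M0 ≤ h x := by
    obtain ⟨m, hm⟩ := hcomp.bddBelow_image hcont.continuousOn
    exact ⟨-m, fun x hx => by simpa using hm ⟨x, hx, rfl⟩⟩
  have key : (n : ℝ) / (n + 1) * v ≤ f 0 := by
    apply final1d n hn f v M0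
    · exact Real.rpow_pos_of_pos hKpos' _
    · exact fun t => Real.rpow_nonneg ENNReal.toReal_nonneg _
    · intro t
      exact Real.rpow_le_rpow ENNReal.toReal_nonneg (ENNReal.toReal_mono hKfin (hKtK t))
        (by positivity)
    · refine ⟨min (-1) (-M0), by simp, ?_⟩
      have : Kt (min (-1) (-M0)) = K :=
        Set.inter_eq_left.2 fun x hx => (min_le_right _ _).trans (hM0 x hx)
      simp only [f, v, this]
    · intro s t hst
      refine Real.rpow_le_rpow ENNReal.toReal_nonneg (ENNReal.toReal_mono (hKtfin s)
        (measure_mono ?_)) (by positivity)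
      exact fun x hx => ⟨hx.1, hst.trans hx.2⟩
    · intro s t m m' hs ht hm hm' hmm
      have e : ∀ t, volume (Kt t) = ENNReal.ofReal (f t ^ n) := fun t => by
        rw [hfn, ENNReal.ofReal_toReal (hKtfin t)]
      have := bm n (Kt s) (Kt t) (Kt (m * s + m' * t)) (hKtm _) (hKtm _) (hKtm _) m m' hm hm'
        (f s) (f t) hs ht (e s) (e t) ?_
      · rw [e, ENNReal.ofReal_le_ofReal_iff (pow_nonneg (Real.rpow_nonneg ENNReal.toReal_nonneg _) _)] at this
        exact le_of_pow_le_pow_left₀ hn (Real.rpow_nonneg ENNReal.toReal_nonneg _) this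
      · rintro x ⟨hx, hx'⟩ y ⟨hy, hy'⟩
        refine ⟨hconv hx hy hm.le hm'.le hmm, ?_⟩
        simp only [Set.mem_ofPred_eq, h, map_add, map_smul, smul_eq_mul] at *
        have : L b = m * L b + m' * L b := by rw [← add_mul, hmm, one_mul]
        have h1 := mul_le_mul_of_nonneg_left hx' hm.le
        have h2 := mul_le_mul_of_nonneg_left hy' hm'.le
        linarith
    · by_contra! hcon
      have hz : ∀ t > 0, volume (Kt t) = 0 := by
        intro t ht
        have h1 : f t = 0 := le_antisymm (hcon t ht) (Real.rpow_nonneg ENNReal.toReal_nonneg _)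
        have h2 := hfn t
        rw [h1, zero_pow hn, eq_comm, ENNReal.toReal_eq_zero_iff] at h2
        exact h2.resolve_right (hKtfin t)
      have hnull : volume (K ∩ {x | 0 < h x}) = 0 := by
        refine measure_mono_null (t := ⋃ k : ℕ, Kt (1 / ((k : ℝ) + 1))) ?_
          (measure_iUnion_null fun k => hz _ (by positivity))
        rintro x ⟨hx, hx'⟩
        obtain ⟨k, hk⟩ := exists_nat_one_div_lt (show 0 < h x from hx')
        exact Set.mem_iUnion.2 ⟨k, hx, hk.le⟩
      have hae : ∀ᵐ x ∂(volume.restrict K), 0 ≤ -h x := by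
        rw [ae_restrict_iff' hKm, ae_iff]
        refine measure_mono_null ?_ hnull
        intro x hx
        simp only [Set.mem_ofPred_eq, Classical.not_imp, not_le] at hx
        exact ⟨hx.1, by simpa using hx.2⟩
      have h0 := (integral_eq_zero_iff_of_nonneg_ae hae hhi.neg).1 (by
        simpa [integral_neg] using hinth)
      have hnull2 : volume (interior K ∩ {x | h x ≠ 0}) = 0 := by
        have h1 : ∀ᵐ x ∂(volume.restrict K), h x = 0 := by
          filter_upwards [h0] with x hx
          simpa using hx
        rw [ae_restrict_iff' hKm, ae_iff] at h1
        refine measure_mono_null ?_ h1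
        rintro x ⟨hx, hx'⟩
        simp only [Set.mem_ofPred_eq, Classical.not_imp]
        exact ⟨interior_subset hx, hx'⟩
      have hop : IsOpen (interior K ∩ {x | h x ≠ 0}) :=
        isOpen_interior.inter (isOpen_ne_fun hcont continuous_const)
      have hemp := (hop.measure_eq_zero_iff volume).1 hnull2
      have hzero : ∀ x ∈ interior K, h x = 0 := by
        intro x hx
        by_contra hne
        have : x ∈ interior K ∩ {x | h x ≠ 0} := ⟨hx, hne⟩
        rw [hemp] at this
        exact this
      obtain ⟨x, hx⟩ := hint
      have hc : Continuous fun ε : ℝ => x + ε • θ := by fun_prop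
      have hev : ∀ᶠ ε : ℝ in nhds 0, x + ε • θ ∈ interior K := by
        apply hc.continuousAt.eventually_mem
        simpa using isOpen_interior.mem_nhds hx
      obtain ⟨ε, hε, hεp⟩ := ((hev.filter_mono nhdsWithin_le_nhds).and
        (self_mem_nhdsWithin (a := (0:ℝ)) (s := Set.Ioi 0))).exists
      have h1 := hzero _ hx
      have h2 := hzero _ hε
      have h3 : L θ = 1 := by
        rw [hL, ← hθ]
        exact Finset.sum_congr rfl fun i _ => by ring
      simp only [h, map_add, map_smul, smul_eq_mul, h3, mul_one] at h1 h2
      have : 0 < ε := hεp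
      linarith
    · intro M hM
      have hci : Integrable (fun _ : Fin n → ℝ => M) (volume.restrict K) :=
        integrable_const_iff.2 (Or.inr (by simpa [isFiniteMeasure_restrict] using hKfin))
      have h1 : ∫ x in K, (h x + M) = M * v ^ n := by
        rw [integral_add hhi hci, hinth, hvn]
        simp [Measure.real, mul_comm]
      rw [← h1, Integrable.integral_eq_integral_meas_le (f := fun x => h x + M) (hhi.add hci)]
      · refine setIntegral_congr_fun measurableSet_Ioi fun t ht => ?_
        simp only [hfn]
        have : MeasurableSet {x | t ≤ h x + M} :=
          measurableSet_le measurable_const (hcont.measurable.add measurable_const)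
        simp only [Measure.real]
        rw [Measure.restrict_apply this, Set.inter_comm]
        congr 3
        ext x
        simp [sub_le_iff_le_add]
      · rw [Filter.EventuallyLE, ae_restrict_iff' hKm]
        refine Filter.Eventually.of_forall fun x hx => ?_
        have := hM0 x hx
        simp only [Pi.zero_apply]
        linarith
  rw [hHK, ← hfn, ← hvn, ← mul_pow]
  refine pow_le_pow_left₀ ?_ key n
  have : 0 ≤ v := Real.rpow_nonneg ENNReal.toReal_nonneg _
  positivity
end
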